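/- arXiv:1804.04859 — 10 statements merged into one kernel-verified Lean document; each statement's English description precedes it below -/
import Mathlib

section
/- Let a, b : ℕ → ℝ with a i > 0 and b i > 0 for all i, and let μ = Measure.infinitePi (fun i => gaussianReal 0 (a i)) and ν = Measure.infinitePi (fun i => gaussianReal 0 (b i)) be the countable product probability measures on ℕ → ℝ. Then exactly one of the following holds: either μ and ν are equivalent (μ ≪ ν and ν ≪ μ), or μ and ν are mutually singular. -/
open MeasureTheory ProbabilityTheory

/-- Combining the coordinates in `s` of one family with the other coordinates of a second family is
a measurable operation. -/
lemma measurable_finset_piecewise {ι : Type*} {X : ι → Type*} [∀ i, MeasurableSpace (X i)]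
    [DecidableEq ι] (s : Finset ι) :
    Measurable (fun p : (∀ i, X i) × (∀ i, X i) ↦ s.piecewise p.1 p.2) := by
  refine measurable_pi_lambda _ fun i ↦ ?_
  by_cases hi : i ∈ s <;> simp only [hi, Finset.piecewise, if_true, if_false] <;> fun_prop

/-- Replacing the coordinates in `s` of a sample of `infinitePi ν` by those of an independent
sample of `infinitePi μ` yields a sample of the product measure with the corresponding factors. -/
lemma infinitePi_prod_map_piecewise {ι : Type*} {X : ι → Type*} [∀ i, MeasurableSpace (X i)]
    [DecidableEq ι] (s : Finset ι) (μ ν κ : ∀ i, Measure (X i)) [∀ i, IsProbabilityMeasure (μ i)]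
    [∀ i, IsProbabilityMeasure (ν i)] [∀ i, IsProbabilityMeasure (κ i)]
    (hμ : ∀ i ∈ s, κ i = μ i) (hν : ∀ i ∉ s, κ i = ν i) :
    ((Measure.infinitePi μ).prod (Measure.infinitePi ν)).map
      (fun p ↦ s.piecewise p.1 p.2) = Measure.infinitePi κ := by
  refine Measure.eq_infinitePi _ fun F t ht ↦ ?_
  have hpre : (fun p : (∀ i, X i) × (∀ i, X i) ↦ s.piecewise p.1 p.2) ⁻¹' (Set.pi F t)
      = (Set.pi ↑(F ∩ s) t) ×ˢ (Set.pi ↑(F \ s) t) := by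
    ext p
    simp only [Set.mem_preimage, Set.mem_pi, Set.mem_prod, Finset.mem_coe, Finset.mem_inter,
      Finset.mem_sdiff]
    constructor
    · refine fun h ↦ ⟨fun i hi ↦ ?_, fun i hi ↦ ?_⟩
      · simpa [hi.2] using h i hi.1
      · simpa [hi.2] using h i hi.1
    · intro h i hi
      by_cases his : i ∈ s
      · simpa [his] using h.1 i ⟨hi, his⟩
      · simpa [his] using h.2 i ⟨hi, his⟩
  rw [Measure.map_apply (measurable_finset_piecewise s)
      (MeasurableSet.pi F.countable_toSet fun i _ ↦ ht i), hpre,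
    Measure.prod_prod, Measure.infinitePi_pi _ fun i _ ↦ ht i,
    Measure.infinitePi_pi _ fun i _ ↦ ht i,
    ← Finset.prod_inter_mul_prod_sdiff F s (fun i ↦ κ i (t i))]
  congr 1
  · exact Finset.prod_congr rfl fun i hi ↦ by rw [hμ i (Finset.mem_inter.1 hi).2]
  · exact Finset.prod_congr rfl fun i hi ↦ by rw [hν i (Finset.mem_sdiff.1 hi).2]

/-- Resampling the coordinate `i` of a product measure replaces the factor at `i`. -/
lemma prod_infinitePi_map_update {ι : Type*} {X : ι → Type*} [∀ i, MeasurableSpace (X i)]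
    [DecidableEq ι] (i : ι) (ν κ : ∀ i, Measure (X i))
    [∀ i, IsProbabilityMeasure (ν i)] [∀ i, IsProbabilityMeasure (κ i)]
    (hν : ∀ j ≠ i, κ j = ν j) :
    ((κ i).prod (Measure.infinitePi ν)).map (fun p ↦ Function.update p.2 i p.1)
      = Measure.infinitePi κ := by
  rw [← infinitePi_prod_map_piecewise {i} κ ν κ (fun _ _ ↦ rfl) (by simpa using hν),
    ← Measure.infinitePi_map_eval κ i]
  nth_rw 1 [← Measure.map_id (μ := Measure.infinitePi ν)]
  have hmeas : Measurable (fun p : X i × (∀ j, X j) ↦ Function.update p.2 i p.1) :=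
    measurable_update'.comp measurable_swap
  rw [Measure.map_prod_map _ _ (by fun_prop) measurable_id, Measure.map_map hmeas (by fun_prop)]
  congr 1
  ext p j
  by_cases hj : j = i
  · subst hj; simp
  · simp [hj]

/-- Product measures that differ in finitely many factors are absolutely continuous as soon as
their factors are. -/
lemma infinitePi_absolutelyContinuous_of_finset {ι : Type*} {X : ι → Type*}
    [∀ i, MeasurableSpace (X i)] (s : Finset ι) (μ ν : ∀ i, Measure (X i))
    [∀ i, IsProbabilityMeasure (μ i)] [∀ i, IsProbabilityMeasure (ν i)]
    (hμν : ∀ i ∈ s, μ i ≪ ν i) (h : ∀ i ∉ s, μ i = ν i) :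
    Measure.infinitePi μ ≪ Measure.infinitePi ν := by
  classical
  induction s using Finset.induction_on generalizing μ with
  | empty =>
    obtain rfl : μ = ν := funext fun i ↦ h i (by simp)
    exact Measure.AbsolutelyContinuous.rfl
  | insert i s hi ih =>
    have hprob (j) : IsProbabilityMeasure (Function.update μ i (ν i) j) := by
      by_cases hj : j = i
      · subst hj; simp only [Function.update_self]; infer_instance
      · simp only [Function.update_of_ne hj]; infer_instance
    have hκ : Measure.infinitePi (Function.update μ i (ν i)) ≪ Measure.infinitePi ν := by
      refine ih _ (fun j hj ↦ ?_) fun j hj ↦ ?_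
      · rw [Function.update_of_ne (by rintro rfl; exact hi hj)]
        exact hμν j (Finset.mem_insert_of_mem hj)
      · by_cases hji : j = i
        · subst hji; simp
        · rw [Function.update_of_ne hji]
          exact h j (by simp [hji, hj])
    refine Measure.AbsolutelyContinuous.trans ?_ hκ
    rw [← prod_infinitePi_map_update i μ μ fun _ _ ↦ rfl,
      ← prod_infinitePi_map_update i μ (Function.update μ i (ν i))
        fun j hj ↦ Function.update_of_ne hj _ _]
    refine Measure.AbsolutelyContinuous.map (Measure.AbsolutelyContinuous.prod ?_ .rfl) ?_
    · simpa using hμν i (Finset.mem_insert_self i s)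
    · exact measurable_update'.comp measurable_swap

/-- A measure is absolutely continuous with respect to another one off some null set of the
latter. -/
lemma exists_measurableSet_null_and_restrict_compl_absolutelyContinuous {α : Type*}
    [MeasurableSpace α] (μ ν : Measure α) [μ.HaveLebesgueDecomposition ν] :
    ∃ S, MeasurableSet S ∧ ν S = 0 ∧ μ.restrict Sᶜ ≪ ν := by
  obtain ⟨t, ht, hst, hνt⟩ := Measure.mutuallySingular_singularPart μ ν
  refine ⟨tᶜ, ht.compl, hνt, ?_⟩
  rw [compl_compl]
  nth_rw 1 [← Measure.singularPart_add_rnDeriv μ ν]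
  rw [Measure.restrict_add, Measure.restrict_eq_zero.2 hst, zero_add]
  exact Measure.restrict_le_self.absolutelyContinuous.trans (withDensity_absolutelyContinuous _ _)

/-- The σ-algebra of events that depend only on the coordinates `i ≥ n` contains every measurable
set that is unaffected by changing the coordinates `i < n`. -/
lemma measurableSet_iSup_comap_eval {X : ℕ → Type*} [∀ i, MeasurableSpace (X i)] {n : ℕ}
    {T : Set (∀ i, X i)} (hT : MeasurableSet T) (y : ∀ i, X i)
    (h : ∀ x, (Finset.range n).piecewise y x ∈ T ↔ x ∈ T) :
    MeasurableSet[⨆ i ≥ n, MeasurableSpace.comap (fun x : ∀ i, X i ↦ x i) inferInstance] T := by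
  have hpre : (fun x ↦ (Finset.range n).piecewise y x) ⁻¹' T = T := Set.ext h
  rw [← hpre]
  refine @measurableSet_preimage _ _ (_) _ _ _ ?_ hT
  refine @measurable_pi_lambda _ _ _ (_) _ _ fun i ↦ ?_
  by_cases hi : i < n
  · simp only [Finset.piecewise, Finset.mem_range, hi, if_true]
    exact measurable_const
  · simp only [Finset.piecewise, Finset.mem_range, hi, if_false]
    exact (comap_measurable _).mono (le_iSup₂_of_le i (not_lt.1 hi) le_rfl) le_rfl

/-- **Kolmogorov's 0-1 law** for product measures: an event unaffected by changing
finitely many coordinates has probability zero or one. -/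
lemma infinitePi_measure_zero_or_one {X : ℕ → Type*} [∀ i, MeasurableSpace (X i)]
    (μ : ∀ i, Measure (X i)) [∀ i, IsProbabilityMeasure (μ i)] {T : Set (∀ i, X i)}
    (hT : MeasurableSet T) (h : ∀ n x y, (Finset.range n).piecewise y x ∈ T ↔ x ∈ T) :
    Measure.infinitePi μ T = 0 ∨ Measure.infinitePi μ T = 1 := by
  have (i : ℕ) : Nonempty (X i) := (μ i).nonempty_of_neZero
  refine measure_zero_or_one_of_measurableSet_limsup_atTop
    (s := fun i ↦ MeasurableSpace.comap (fun x : ∀ i, X i ↦ x i) inferInstance)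
    (fun i ↦ (measurable_pi_apply i).comap_le)
    (iIndepFun_infinitePi (X := fun _ x ↦ x) fun _ ↦ measurable_id) ?_
  rw [Filter.limsup_eq_iInf_iSup_of_nat, MeasurableSpace.measurableSet_iInf]
  exact fun n ↦ measurableSet_iSup_comap_eval hT (Classical.arbitrary _) fun x ↦ h n x _

/-- **Kakutani's dichotomy**: if every factor of a countable product of probability measures is
absolutely continuous with respect to the corresponding factor of another one, then the first
product is absolutely continuous with respect to the second one or singular to it. -/
theorem infinitePi_absolutelyContinuous_or_mutuallySingular {X : ℕ → Type*}
    [∀ i, MeasurableSpace (X i)] (μ ν : ∀ i, Measure (X i)) [∀ i, IsProbabilityMeasure (μ i)]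
    [∀ i, IsProbabilityMeasure (ν i)] (hμν : ∀ i, μ i ≪ ν i) :
    Measure.infinitePi μ ≪ Measure.infinitePi ν ∨
      Measure.infinitePi μ ⟂ₘ Measure.infinitePi ν := by
  set P := Measure.infinitePi μ with hP
  set Q := Measure.infinitePi ν with hQ
  obtain ⟨S, hS, hQS, hPS⟩ :=
    exists_measurableSet_null_and_restrict_compl_absolutelyContinuous P Q
  let φ (n : ℕ) (p : (∀ i, X i) × (∀ i, X i)) : ∀ i, X i := (Finset.range n).piecewise p.1 p.2
  have hφ (n) : Measurable (φ n) := measurable_finset_piecewise (Finset.range n)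
  -- the points from which `S` is hit with positive probability on resampling `n` coordinates
  let A (n : ℕ) : Set (∀ i, X i) := {x | P ((fun y ↦ φ n (y, x)) ⁻¹' S) ≠ 0}
  have hA (n) : MeasurableSet (A n) := by
    have := measurable_measure_prodMk_right (μ := P) (hφ n hS)
    exact this (measurableSet_singleton 0).compl
  have hA_inv {m n} (hmn : m ≤ n) (x y) : φ m (y, x) ∈ A n ↔ x ∈ A n := by
    have hφφ (z) : φ n (z, φ m (y, x)) = φ n (z, x) := by
      ext i
      by_cases hi : i < n
      · simp [φ, hi]
      · simp [φ, Finset.piecewise, hi, show ¬ i < m by omega]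
    simp only [A, Set.mem_ofPred_eq, hφφ]
  have hQA (n) : Q (A n) = 0 := by
    have hprob (i) : IsProbabilityMeasure ((Finset.range n).piecewise μ ν i) := by
      by_cases hi : i ∈ Finset.range n <;> simp only [hi, Finset.piecewise, if_true, if_false] <;>
        infer_instance
    have hmap : (P.prod Q).map (φ n) ≪ Q := by
      rw [infinitePi_prod_map_piecewise _ μ ν ((Finset.range n).piecewise μ ν)
        (fun i hi ↦ by simp [Finset.piecewise, hi]) (fun i hi ↦ by simp [Finset.piecewise, hi])]
      exact infinitePi_absolutelyContinuous_of_finset (Finset.range n) _ _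
        (fun i hi ↦ by simpa [Finset.piecewise, hi] using hμν i)
        (fun i hi ↦ by simp [Finset.piecewise, hi])
    have h0 := hmap hQS
    rw [Measure.map_apply (hφ n) hS, Measure.prod_apply_symm (hφ n hS),
      lintegral_eq_zero_iff (measurable_measure_prodMk_right (hφ n hS))] at h0
    exact h0
  have hSA (n) : P (S \ A n) = 0 := by
    rw [hP, ← infinitePi_prod_map_piecewise (Finset.range n) μ μ μ (fun _ _ ↦ rfl) fun _ _ ↦ rfl]
    change ((P.prod P).map (φ n)) _ = 0
    rw [Measure.map_apply (hφ n) (hS.diff (hA n)),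
      Measure.prod_apply_symm (hφ n (hS.diff (hA n)))]
    refine lintegral_eq_zero_of_ae_eq_zero (.of_forall fun x ↦ ?_)
    by_cases hx : x ∈ A n
    · refine measure_mono_null (fun y hy ↦ ?_) (measure_empty (μ := P))
      exact hy.2 ((hA_inv le_rfl x y).2 hx)
    · exact measure_mono_null (fun y hy ↦ hy.1) (not_not.1 hx)
  let T : Set (∀ i, X i) := Filter.limsup A Filter.atTop
  have hT : MeasurableSet T := .measurableSet_limsup hA
  have hQT : Q T = 0 := measure_limsup_atTop_eq_zero (by simp [hQA])
  have hST : P (S \ T) = 0 := by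
    refine measure_mono_null (t := ⋃ n, S \ A n) (fun x hx ↦ ?_) (measure_iUnion_null hSA)
    by_contra hxA
    simp only [Set.mem_iUnion, Set.mem_sdiff, not_exists, not_and, not_not] at hxA
    refine hx.2 (Filter.mem_limsup_iff_frequently_mem.2 ?_)
    exact Filter.Frequently.of_forall fun n ↦ hxA n hx.1
  have hT_inv (n x y) : (Finset.range n).piecewise y x ∈ T ↔ x ∈ T := by
    simp only [T, Filter.mem_limsup_iff_frequently_mem]
    refine Filter.frequently_congr ?_
    filter_upwards [Filter.eventually_ge_atTop n] with m hm using hA_inv hm x y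
  rcases infinitePi_measure_zero_or_one μ hT hT_inv with hPT | hPT
  · left
    have hPS0 : P S = 0 := by
      refine measure_mono_null (fun x hx ↦ ?_) (measure_union_null hST hPT)
      by_cases hxT : x ∈ T <;> simp [hx, hxT]
    rwa [Measure.restrict_eq_self_of_ae_mem (s := Sᶜ) (measure_eq_zero_iff_ae_notMem.1 hPS0)] at hPS
  · right
    exact ⟨Tᶜ, hT.compl, (prob_compl_eq_zero_iff hT).2 hPT, by rwa [compl_compl]⟩

/-- A measure on a sequence space with the marginals of a product measure on every initial segment
is the product measure. -/
lemma eq_infinitePi_of_map_fin {X : ℕ → Type*} [∀ i, MeasurableSpace (X i)]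
    (κ : ∀ i, Measure (X i)) [∀ i, IsProbabilityMeasure (κ i)] {μ : Measure (∀ i, X i)}
    (h : ∀ n : ℕ, μ.map (fun x (i : Fin n) ↦ x i) = Measure.pi (fun i : Fin n ↦ κ i)) :
    μ = Measure.infinitePi κ := by
  classical
  refine Measure.eq_infinitePi _ fun s t ht ↦ ?_
  obtain ⟨n, hn⟩ : ∃ n, s ⊆ Finset.range n := s.exists_nat_subset_range
  let u (i : ℕ) : Set (X i) := if i ∈ s then t i else Set.univ
  have hu (i) : MeasurableSet (u i) := by
    by_cases hi : i ∈ s <;> simp [u, hi, ht]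
  have hpre : Set.pi s t = (fun x (i : Fin n) ↦ x i) ⁻¹' (Set.univ.pi fun i : Fin n ↦ u i) := by
    ext x
    simp only [Set.mem_pi, Finset.mem_coe, Set.mem_preimage, Set.mem_univ, true_imp_iff]
    refine ⟨fun hx i ↦ ?_, fun hx i hi ↦ ?_⟩
    · by_cases hi : (i : ℕ) ∈ s <;> simp [u, hi, hx]
    · simpa [u, hi] using hx ⟨i, Finset.mem_range.1 (hn hi)⟩
  rw [hpre, ← Measure.map_apply (by fun_prop) (.univ_pi fun i : Fin n ↦ hu i), h, Measure.pi_pi,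
    Fin.prod_univ_eq_prod_range (fun i ↦ κ i (u i)) n, ← Finset.prod_subset hn]
  · exact Finset.prod_congr rfl fun i hi ↦ by simp [u, hi]
  · intro i _ hi
    simp [u, hi]

/-- **Feldman–Hajek dichotomy** for countable products of centred Gaussian measures:
the product measures `μ = ⨂ᵢ N(0, a i)` and `ν = ⨂ᵢ N(0, b i)` on `ℕ → ℝ`
(characterised by their finite-dimensional marginals) are either equivalent or
mutually singular, and exactly one of these alternatives holds. -/
theorem feldmanHajek_dichotomy_product_gaussian
    (a b : ℕ → ℝ) (ha : ∀ i, 0 < a i) (hb : ∀ i, 0 < b i)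
    (μ ν : Measure (ℕ → ℝ)) [IsProbabilityMeasure μ] [IsProbabilityMeasure ν]
    (hμ : ∀ n : ℕ, μ.map (fun x (i : Fin n) => x i)
      = Measure.pi (fun i : Fin n => gaussianReal 0 (a i).toNNReal))
    (hν : ∀ n : ℕ, ν.map (fun x (i : Fin n) => x i)
      = Measure.pi (fun i : Fin n => gaussianReal 0 (b i).toNNReal)) :
    Xor' (μ ≪ ν ∧ ν ≪ μ) (μ ⟂ₘ ν) := by
  have hac {v w : ℝ} (hv : 0 < v) (hw : 0 < w) :
      gaussianReal 0 v.toNNReal ≪ gaussianReal 0 w.toNNReal :=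
    (gaussianReal_absolutelyContinuous _ (Real.toNNReal_pos.2 hv).ne').trans
      (gaussianReal_absolutelyContinuous' _ (Real.toNNReal_pos.2 hw).ne')
  have hμν := infinitePi_absolutelyContinuous_or_mutuallySingular
    (fun i ↦ gaussianReal 0 (a i).toNNReal) (fun i ↦ gaussianReal 0 (b i).toNNReal)
    fun i ↦ hac (ha i) (hb i)
  have hνμ := infinitePi_absolutelyContinuous_or_mutuallySingular
    (fun i ↦ gaussianReal 0 (b i).toNNReal) (fun i ↦ gaussianReal 0 (a i).toNNReal)
    fun i ↦ hac (hb i) (ha i)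
  rw [← eq_infinitePi_of_map_fin (fun i ↦ gaussianReal 0 (a i).toNNReal) hμ,
    ← eq_infinitePi_of_map_fin (fun i ↦ gaussianReal 0 (b i).toNNReal) hν] at hμν hνμ
  have hns (h : μ ≪ ν) : ¬ μ ⟂ₘ ν := fun hs ↦
    IsProbabilityMeasure.ne_zero μ (Measure.eq_zero_of_absolutelyContinuous_of_mutuallySingular h hs)
  rcases hμν with h₁ | h₁
  · rcases hνμ with h₂ | h₂
    · exact Or.inl ⟨⟨h₁, h₂⟩, hns h₁⟩
    · exact absurd h₂.symm (hns h₁)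
  · exact Or.inr ⟨h₁, fun h ↦ hns h.1 h₁⟩
end

section
/- Let a, b : ℕ → ℝ with a i > 0 and b i > 0 for all i, and let μ = Measure.infinitePi (fun i => gaussianReal 0 (a i)) and ν = Measure.infinitePi (fun i => gaussianReal 0 (b i)) be the countable product probability measures on ℕ → ℝ. Then μ and ν are equivalent (μ ≪ ν and ν ≪ μ) if and only if ∑_{i=0}^{∞} (a i / b i − 1)² < ∞ (i.e. the sequence i ↦ (a i / b i − 1)² is summable). -/
open MeasureTheory ProbabilityTheory

section GaussianIntegrals

theorem gaussianPDFReal_zero_toNNReal {v : ℝ} (hv : 0 < v) (x : ℝ) :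
    gaussianPDFReal 0 v.toNNReal x = (√(2 * Real.pi * v))⁻¹ * Real.exp (-(1 / (2 * v)) * x ^ 2) := by
  rw [gaussianPDFReal, Real.coe_toNNReal _ hv.le, sub_zero]
  congr 2
  field_simp

theorem sqrt_gaussianPDFReal_mul {v w : ℝ} (hv : 0 < v) (hw : 0 < w) (x : ℝ) :
    √(gaussianPDFReal 0 v.toNNReal x * gaussianPDFReal 0 w.toNNReal x) =
      √((√(2 * Real.pi * v))⁻¹ * (√(2 * Real.pi * w))⁻¹) *
        Real.exp (-((v + w) / (4 * v * w)) * x ^ 2) := by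
  rw [gaussianPDFReal_zero_toNNReal hv, gaussianPDFReal_zero_toNNReal hw,
    mul_mul_mul_comm, Real.sqrt_mul (by positivity), ← Real.exp_add, ← Real.exp_half]
  congr 2
  field_simp
  ring

theorem integrable_sqrt_gaussianPDFReal_mul {v w : ℝ} (hv : 0 < v) (hw : 0 < w) :
    Integrable fun x => √(gaussianPDFReal 0 v.toNNReal x * gaussianPDFReal 0 w.toNNReal x) := by
  simp_rw [sqrt_gaussianPDFReal_mul hv hw]
  exact (integrable_exp_neg_mul_sq (by positivity)).const_mul _

theorem integral_sqrt_gaussianPDFReal_mul_pow_four {v w : ℝ} (hv : 0 < v) (hw : 0 < w) :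
    (∫ x, √(gaussianPDFReal 0 v.toNNReal x * gaussianPDFReal 0 w.toNNReal x)) ^ 4 =
      1 - ((v - w) / (v + w)) ^ 2 := by
  have hpi := Real.pi_pos
  simp_rw [sqrt_gaussianPDFReal_mul hv hw]
  rw [integral_const_mul, integral_gaussian, show (4 : ℕ) = 2 * 2 from rfl, pow_mul, mul_pow,
    Real.sq_sqrt (by positivity), Real.sq_sqrt (by positivity), mul_pow, mul_pow, inv_pow, inv_pow,
    Real.sq_sqrt (by positivity), Real.sq_sqrt (by positivity)]
  field_simp
  ring

theorem gaussianPDFReal_sq_div {v w : ℝ} (hv : 0 < v) (hw : 0 < w) (x : ℝ) :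
    gaussianPDFReal 0 v.toNNReal x ^ 2 / gaussianPDFReal 0 w.toNNReal x =
      √(2 * Real.pi * w) / (2 * Real.pi * v) *
        Real.exp (-((2 * w - v) / (2 * v * w)) * x ^ 2) := by
  have hpi := Real.pi_pos
  rw [gaussianPDFReal_zero_toNNReal hv, gaussianPDFReal_zero_toNNReal hw, mul_pow, inv_pow,
    Real.sq_sqrt (by positivity), ← Real.exp_nat_mul, mul_div_mul_comm, ← Real.exp_sub]
  congr 1
  · field_simp
  · congr 1
    push_cast
    field_simp
    ring

theorem integrable_gaussianPDFReal_sq_div {v w : ℝ} (hv : 0 < v) (hw : 0 < w) (h : v < 2 * w) :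
    Integrable fun x => gaussianPDFReal 0 v.toNNReal x ^ 2 / gaussianPDFReal 0 w.toNNReal x := by
  simp_rw [gaussianPDFReal_sq_div hv hw]
  exact (integrable_exp_neg_mul_sq (div_pos (by linarith) (by positivity))).const_mul _

theorem integral_gaussianPDFReal_sq_div_sq {v w : ℝ} (hv : 0 < v) (hw : 0 < w) (h : v < 2 * w) :
    (∫ x, gaussianPDFReal 0 v.toNNReal x ^ 2 / gaussianPDFReal 0 w.toNNReal x) ^ 2 =
      (1 - (v / w - 1) ^ 2)⁻¹ := by
  have hpi := Real.pi_pos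
  have h' : 0 < 2 * w - v := by linarith
  simp_rw [gaussianPDFReal_sq_div hv hw]
  rw [integral_const_mul, integral_gaussian, mul_pow, div_pow, Real.sq_sqrt (by positivity),
    Real.sq_sqrt (by positivity)]
  have : 1 - (v / w - 1) ^ 2 = v * (2 * w - v) / w ^ 2 := by field_simp; ring
  rw [this]
  field_simp

end GaussianIntegrals

section FiniteProduct

variable {ι : Type*} [Fintype ι]

theorem pi_gaussianReal_eq_withDensity {v : ι → ℝ} (hv : ∀ i, 0 < v i) :
    Measure.pi (fun i => gaussianReal 0 (v i).toNNReal) =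
      (volume : Measure (ι → ℝ)).withDensity
        fun x => ENNReal.ofReal (∏ i, gaussianPDFReal 0 (v i).toNNReal (x i)) := by
  refine Measure.pi_eq fun s hs => ?_
  have hint : ∀ i, Integrable (gaussianPDFReal 0 (v i).toNNReal) (volume.restrict (s i)) :=
    fun i => (integrable_gaussianPDFReal _ _).restrict
  rw [withDensity_apply _ (.univ_pi hs), volume_pi, Measure.restrict_pi_pi,
    ← ofReal_integral_eq_lintegral_ofReal (Integrable.fintype_prod hint)
      (.of_forall fun x => Finset.prod_nonneg fun i _ => gaussianPDFReal_nonneg _ _ _),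
    integral_fintype_prod_eq_prod, ENNReal.ofReal_prod_of_nonneg fun i _ =>
      integral_nonneg fun x => gaussianPDFReal_nonneg _ _ _]
  refine Finset.prod_congr rfl fun i _ => ?_
  rw [gaussianReal_apply_eq_integral _ (by simpa using hv i)]

theorem integrable_prod_gaussianPDFReal (v : ι → ℝ) :
    Integrable fun x : ι → ℝ => ∏ i, gaussianPDFReal 0 (v i).toNNReal (x i) :=
  Integrable.fintype_prod fun _ => integrable_gaussianPDFReal _ _

theorem pi_gaussianReal_real_eq {v : ι → ℝ} (hv : ∀ i, 0 < v i) {B : Set (ι → ℝ)}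
    (hB : MeasurableSet B) :
    (Measure.pi (fun i => gaussianReal 0 (v i).toNNReal)).real B =
      ∫ x in B, ∏ i, gaussianPDFReal 0 (v i).toNNReal (x i) := by
  have hnn : ∀ x : ι → ℝ, 0 ≤ ∏ i, gaussianPDFReal 0 (v i).toNNReal (x i) := fun x =>
    Finset.prod_nonneg fun i _ => gaussianPDFReal_nonneg _ _ _
  rw [measureReal_def, pi_gaussianReal_eq_withDensity hv, withDensity_apply _ hB,
    ← ofReal_integral_eq_lintegral_ofReal (integrable_prod_gaussianPDFReal v).restrict
      (.of_forall hnn), ENNReal.toReal_ofReal (integral_nonneg hnn)]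

theorem pi_gaussianReal_real_le {v w : ι → ℝ} (hv : ∀ i, 0 < v i) (hw : ∀ i, 0 < w i)
    (h : ∀ i, v i < 2 * w i) {K : ℝ} (hK : 0 < K) {B : Set (ι → ℝ)} (hB : MeasurableSet B) :
    (Measure.pi (fun i => gaussianReal 0 (v i).toNNReal)).real B ≤
      (∏ i, ∫ x, gaussianPDFReal 0 (v i).toNNReal x ^ 2 / gaussianPDFReal 0 (w i).toNNReal x) / K +
        K * (Measure.pi (fun i => gaussianReal 0 (w i).toNNReal)).real B := by
  have hint : Integrable fun x : ι → ℝ => ∏ i, gaussianPDFReal 0 (v i).toNNReal (x i) ^ 2 /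
      gaussianPDFReal 0 (w i).toNNReal (x i) :=
    Integrable.fintype_prod fun i => integrable_gaussianPDFReal_sq_div (hv i) (hw i) (h i)
  have hnn : ∀ x : ι → ℝ, 0 ≤ ∏ i, gaussianPDFReal 0 (v i).toNNReal (x i) ^ 2 /
      gaussianPDFReal 0 (w i).toNNReal (x i) := fun x => Finset.prod_nonneg fun i _ =>
    div_nonneg (sq_nonneg _) (gaussianPDFReal_nonneg _ _ _)
  rw [pi_gaussianReal_real_eq hv hB, pi_gaussianReal_real_eq hw hB,
    ← integral_fintype_prod_volume_eq_prod, ← integral_div, ← integral_const_mul]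
  refine le_trans ?_ (add_le_add_left (setIntegral_le_integral (s := B) (hint.div_const K)
    (.of_forall fun x => div_nonneg (hnn x) hK.le)) _)
  rw [← integral_add (hint.div_const K).restrict
    ((integrable_prod_gaussianPDFReal w).const_mul K).restrict]
  refine integral_mono (integrable_prod_gaussianPDFReal v).restrict
    ((hint.div_const K).restrict.add
      ((integrable_prod_gaussianPDFReal w).const_mul K).restrict) fun x => ?_
  simp only [Finset.prod_div_distrib, Finset.prod_pow]
  have hP : 0 < ∏ i, gaussianPDFReal 0 (v i).toNNReal (x i) :=
    Finset.prod_pos fun i _ => gaussianPDFReal_pos _ _ _ (by simpa using hv i)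
  have hQ : 0 < ∏ i, gaussianPDFReal 0 (w i).toNNReal (x i) :=
    Finset.prod_pos fun i _ => gaussianPDFReal_pos _ _ _ (by simpa using hw i)
  generalize (∏ i, gaussianPDFReal 0 (v i).toNNReal (x i)) = P at *
  generalize (∏ i, gaussianPDFReal 0 (w i).toNNReal (x i)) = Q at *
  rw [div_div, div_add' _ _ _ (by positivity), le_div_iff₀ (by positivity)]
  nlinarith [sq_nonneg (P - Q * K), mul_pos hP (mul_pos hQ hK)]

theorem exists_pi_gaussianReal_real_le_affinity {v w : ι → ℝ} (hv : ∀ i, 0 < v i)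
    (hw : ∀ i, 0 < w i) :
    ∃ B : Set (ι → ℝ), MeasurableSet B ∧
      (Measure.pi (fun i => gaussianReal 0 (v i).toNNReal)).real Bᶜ ≤
        ∏ i, ∫ x, √(gaussianPDFReal 0 (v i).toNNReal x * gaussianPDFReal 0 (w i).toNNReal x) ∧
      (Measure.pi (fun i => gaussianReal 0 (w i).toNNReal)).real B ≤
        ∏ i, ∫ x, √(gaussianPDFReal 0 (v i).toNNReal x * gaussianPDFReal 0 (w i).toNNReal x) := by
  have hm : ∀ v : ι → ℝ, Measurable fun x : ι → ℝ =>
      ∏ i, gaussianPDFReal 0 (v i).toNNReal (x i) := fun v =>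
    Finset.measurable_fun_prod _ fun i _ =>
      (measurable_gaussianPDFReal _ _).comp (measurable_pi_apply i)
  have hnn : ∀ (v : ι → ℝ) (x : ι → ℝ), 0 ≤ ∏ i, gaussianPDFReal 0 (v i).toNNReal (x i) :=
    fun v x => Finset.prod_nonneg fun i _ => gaussianPDFReal_nonneg _ _ _
  have hint := Integrable.fintype_prod (μ := fun _ : ι => (volume : Measure ℝ))
    fun i => integrable_sqrt_gaussianPDFReal_mul (hv i) (hw i)
  have hsqrt : ∀ x : ι → ℝ,
      ∏ i, √(gaussianPDFReal 0 (v i).toNNReal (x i) * gaussianPDFReal 0 (w i).toNNReal (x i)) =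
        √((∏ i, gaussianPDFReal 0 (v i).toNNReal (x i)) *
          ∏ i, gaussianPDFReal 0 (w i).toNNReal (x i)) := fun x => by
    rw [← Finset.prod_mul_distrib, Real.sqrt_prod _ fun i _ =>
      mul_nonneg (gaussianPDFReal_nonneg _ _ _) (gaussianPDFReal_nonneg _ _ _)]
  have key : ∀ (u : ι → ℝ) (S : Set (ι → ℝ)), (∀ i, 0 < u i) → MeasurableSet S →
      (∀ x ∈ S, ∏ i, gaussianPDFReal 0 (u i).toNNReal (x i) ≤
        ∏ i, √(gaussianPDFReal 0 (v i).toNNReal (x i) * gaussianPDFReal 0 (w i).toNNReal (x i))) →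
      (Measure.pi (fun i => gaussianReal 0 (u i).toNNReal)).real S ≤
        ∏ i, ∫ x, √(gaussianPDFReal 0 (v i).toNNReal x * gaussianPDFReal 0 (w i).toNNReal x) := by
    intro u S hu hS hle
    rw [pi_gaussianReal_real_eq hu hS, ← integral_fintype_prod_volume_eq_prod]
    exact (setIntegral_mono_on (integrable_prod_gaussianPDFReal u).integrableOn
      hint.integrableOn hS hle).trans (setIntegral_le_integral hint
        (.of_forall fun x => Finset.prod_nonneg fun i _ => Real.sqrt_nonneg _))
  have hB := measurableSet_le (hm w) (hm v)
  refine ⟨_, hB, key v _ hv hB.compl fun x hx => ?_, key w _ hw hB fun x hx => ?_⟩ <;>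
    rw [hsqrt] <;> refine Real.le_sqrt_of_sq_le ?_ <;> rw [sq]
  · exact mul_le_mul_of_nonneg_left (le_of_not_ge hx) (hnn v x)
  · exact mul_le_mul_of_nonneg_right hx (hnn w x)

end FiniteProduct

section CountableProduct

theorem exists_preimage_of_mem_measurableCylinders {t : Set (ℕ → ℝ)}
    (ht : t ∈ measurableCylinders fun _ : ℕ => ℝ) :
    ∃ (n : ℕ) (B : Set (Fin n → ℝ)), MeasurableSet B ∧ t = (fun x (i : Fin n) => x i) ⁻¹' B := by
  obtain ⟨I, S, hS, rfl⟩ := (mem_measurableCylinders _).1 ht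
  have hI : ∀ i : I, (i : ℕ) < I.sup id + 1 := fun i =>
    Nat.lt_succ_of_le (Finset.le_sup (f := id) i.2)
  refine ⟨I.sup id + 1, (fun y (i : I) => y ⟨i, hI i⟩) ⁻¹' S,
    (measurable_pi_lambda _ fun i => measurable_pi_apply _) hS, rfl⟩

theorem infinitePi_gaussianReal_map_fin (c : ℕ → ℝ) (n : ℕ) :
    (Measure.infinitePi fun i => gaussianReal 0 (c i).toNNReal).map (fun x (i : Fin n) => x i) =
      Measure.pi fun i : Fin n => gaussianReal 0 (c i).toNNReal := by
  rw [← Measure.infinitePi_eq_pi]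
  exact Measure.map_infinitePi_infinitePi_of_inj
    (P := fun i => gaussianReal 0 (c i).toNNReal) Fin.val_injective

theorem exists_prod_integral_gaussianPDFReal_sq_div_le {a b : ℕ → ℝ} (ha : ∀ i, 0 < a i)
    (hb : ∀ i, 0 < b i) (hab : ∀ i, a i < 2 * b i) (hs : Summable fun i => (a i / b i - 1) ^ 2) :
    ∃ C : ℝ, ∀ n : ℕ, ∏ i : Fin n, ∫ x, gaussianPDFReal 0 (a i).toNNReal x ^ 2 /
      gaussianPDFReal 0 (b i).toNNReal x ≤ C := by
  have hlt : ∀ i, (a i / b i - 1) ^ 2 < 1 := fun i => by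
    have h1 : 0 < a i / b i := div_pos (ha i) (hb i)
    have h2 : a i / b i < 2 := by rw [div_lt_iff₀ (hb i)]; exact hab i
    nlinarith
  generalize hu : (fun i => (a i / b i - 1) ^ 2) = u at hs
  have hu' : ∀ i, (a i / b i - 1) ^ 2 = u i := fun i => congrFun hu i
  have hu0 : ∀ i, 0 ≤ u i := fun i => hu' i ▸ sq_nonneg _
  simp_rw [hu'] at hlt
  have hsum : Summable fun i => (1 - u i)⁻¹ - 1 := by
    refine .of_norm_bounded_eventually_nat (hs.mul_left 2) ?_
    filter_upwards [hs.tendsto_atTop_zero.eventually_lt_const (by norm_num : (0 : ℝ) < 1 / 2)]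
      with i hi
    have h1 : 0 < 1 - u i := by linarith
    have h2 : (1 - u i)⁻¹ - 1 = u i / (1 - u i) := by field_simp; ring
    rw [h2, Real.norm_of_nonneg (div_nonneg (hu0 i) h1.le), div_le_iff₀ h1]
    nlinarith [hu0 i]
  have hnn : ∀ i, 0 ≤ (1 - u i)⁻¹ - 1 := fun i =>
    sub_nonneg.2 ((one_le_inv₀ (by linarith [hlt i])).2 (by linarith [hu0 i]))
  refine ⟨Real.exp (∑' i, ((1 - u i)⁻¹ - 1)), fun n => ?_⟩
  rw [Fin.prod_univ_eq_prod_range (fun i => ∫ x, gaussianPDFReal 0 (a i).toNNReal x ^ 2 /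
      gaussianPDFReal 0 (b i).toNNReal x)]
  calc _ ≤ ∏ i ∈ Finset.range n, (1 + ((1 - u i)⁻¹ - 1)) := by
        refine Finset.prod_le_prod (fun i _ => integral_nonneg fun x =>
          div_nonneg (sq_nonneg _) (gaussianPDFReal_nonneg _ _ _)) fun i _ => ?_
        have h := integral_gaussianPDFReal_sq_div_sq (ha i) (hb i) (hab i)
        rw [hu' i] at h
        refine le_of_sq_le_sq ?_ (by linarith [hnn i])
        rw [h]
        nlinarith [hnn i]
    _ ≤ Real.exp (∑ i ∈ Finset.range n, ((1 - u i)⁻¹ - 1)) :=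
        Real.prod_one_add_le_exp_sum _ hnn
    _ ≤ _ := Real.exp_le_exp.2 (hsum.sum_le_tsum _ fun i _ => hnn i)

theorem absolutelyContinuous_of_measureReal_cylinder_le {μ ν : Measure (ℕ → ℝ)}
    [IsFiniteMeasure μ] [IsFiniteMeasure ν] {C : ℝ}
    (h : ∀ t ∈ measurableCylinders fun _ : ℕ => ℝ, ∀ K : ℝ, 0 < K →
      μ.real t ≤ C / K + K * ν.real t) : μ ≪ ν := by
  refine Measure.AbsolutelyContinuous.mk fun s hs hνs => ?_
  have hdense := Measure.MeasureDense.of_generateFrom_isSetAlgebra_finite (μ + ν)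
    (isSetAlgebra_measurableCylinders (α := fun _ : ℕ => ℝ)) generateFrom_measurableCylinders.symm
  have hνs' : ν.real s = 0 := by simp [measureReal_def, hνs]
  have hK : ∀ K : ℝ, 0 < K → μ.real s ≤ C / K := fun K hK => by
    refine le_of_forall_pos_le_add fun ε hε => ?_
    obtain ⟨t, ht, hst⟩ := hdense.approx s hs (measure_ne_top _ _) (ε / (K + 1)) (by positivity)
    have hst' : μ.real (symmDiff s t) + ν.real (symmDiff s t) < ε / (K + 1) := by
      rw [← measureReal_add_apply]
      exact (ENNReal.lt_ofReal_iff_toReal_lt (measure_ne_top _ _)).1 hst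
    have h1 : μ.real s ≤ μ.real t + μ.real (symmDiff s t) :=
      (measureReal_mono (fun x hx => by
        by_cases hxt : x ∈ t
        · exact .inl hxt
        · exact .inr (.inl ⟨hx, hxt⟩))).trans (measureReal_union_le _ _)
    have h2 : ν.real t ≤ ν.real s + ν.real (symmDiff s t) :=
      (measureReal_mono (fun x hx => by
        by_cases hxs : x ∈ s
        · exact .inl hxs
        · exact .inr (.inr ⟨hx, hxs⟩))).trans (measureReal_union_le _ _)
    have h3 := h t ht K hK
    have h4 : μ.real (symmDiff s t) + K * ν.real (symmDiff s t) ≤ ε := by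
      rw [lt_div_iff₀ (by positivity)] at hst'
      have := measureReal_nonneg (μ := μ) (s := symmDiff s t)
      have := measureReal_nonneg (μ := ν) (s := symmDiff s t)
      nlinarith
    have h5 := mul_le_mul_of_nonneg_left h2 hK.le
    rw [hνs', zero_add] at h5
    linarith
  have h0 : μ.real s ≤ 0 :=
    ge_of_tendsto (tendsto_const_nhds.div_atTop Filter.tendsto_id)
      ((Filter.eventually_gt_atTop 0).mono hK)
  simpa [measureReal_def, ENNReal.toReal_eq_zero_iff] using h0.antisymm measureReal_nonneg

theorem absolutelyContinuous_of_summable_of_lt_two_mul {a b : ℕ → ℝ} (ha : ∀ i, 0 < a i)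
    (hb : ∀ i, 0 < b i) (hab : ∀ i, a i < 2 * b i) (hs : Summable fun i => (a i / b i - 1) ^ 2)
    {μ ν : Measure (ℕ → ℝ)} [IsProbabilityMeasure μ] [IsProbabilityMeasure ν]
    (hμ : ∀ n : ℕ, μ.map (fun x (i : Fin n) => x i)
      = Measure.pi (fun i : Fin n => gaussianReal 0 (a i).toNNReal))
    (hν : ∀ n : ℕ, ν.map (fun x (i : Fin n) => x i)
      = Measure.pi (fun i : Fin n => gaussianReal 0 (b i).toNNReal)) : μ ≪ ν := by
  obtain ⟨C, hle⟩ := exists_prod_integral_gaussianPDFReal_sq_div_le ha hb hab hs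
  refine absolutelyContinuous_of_measureReal_cylinder_le (C := C) fun t ht K hK => ?_
  obtain ⟨n, B, hB, rfl⟩ := exists_preimage_of_mem_measurableCylinders ht
  have hmeas : Measurable fun (x : ℕ → ℝ) (i : Fin n) => x i := by fun_prop
  rw [← map_measureReal_apply hmeas hB, ← map_measureReal_apply hmeas hB, hμ, hν]
  exact (pi_gaussianReal_real_le (fun i : Fin n => ha i) (fun i => hb i) (fun i => hab i) hK
    hB).trans (by gcongr; exact hle n)

theorem sq_sqrt_sub_one_le {t : ℝ} (ht : 0 ≤ t) : (√t - 1) ^ 2 ≤ (t - 1) ^ 2 := by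
  have h := Real.sq_sqrt ht
  have h0 := Real.sqrt_nonneg t
  have : t - 1 = (√t - 1) * (√t + 1) := by linear_combination -h
  rw [this, mul_pow]
  nlinarith [sq_nonneg (√t - 1), mul_nonneg (sq_nonneg (√t - 1)) h0,
    mul_nonneg (sq_nonneg (√t - 1)) (sq_nonneg √t)]

theorem absolutelyContinuous_of_summable {a b : ℕ → ℝ} (ha : ∀ i, 0 < a i)
    (hb : ∀ i, 0 < b i) (hs : Summable fun i => (a i / b i - 1) ^ 2)
    {μ ν : Measure (ℕ → ℝ)} [IsProbabilityMeasure μ] [IsProbabilityMeasure ν]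
    (hμ : ∀ n : ℕ, μ.map (fun x (i : Fin n) => x i)
      = Measure.pi (fun i : Fin n => gaussianReal 0 (a i).toNNReal))
    (hν : ∀ n : ℕ, ν.map (fun x (i : Fin n) => x i)
      = Measure.pi (fun i : Fin n => gaussianReal 0 (b i).toNNReal)) : μ ≪ ν := by
  have key : ∀ (k : ℕ) (a b : ℕ → ℝ) (μ ν : Measure (ℕ → ℝ)) [IsProbabilityMeasure μ]
      [IsProbabilityMeasure ν], (∀ i, 0 < a i) → (∀ i, 0 < b i) →
      (∀ i, a i / b i < 2 ^ 2 ^ k) → (Summable fun i => (a i / b i - 1) ^ 2) →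
      (∀ n : ℕ, μ.map (fun x (i : Fin n) => x i)
        = Measure.pi (fun i : Fin n => gaussianReal 0 (a i).toNNReal)) →
      (∀ n : ℕ, ν.map (fun x (i : Fin n) => x i)
        = Measure.pi (fun i : Fin n => gaussianReal 0 (b i).toNNReal)) → μ ≪ ν := by
    intro k
    induction k with
    | zero =>
      intro a b μ ν _ _ ha hb hlt hs hμ hν
      refine absolutelyContinuous_of_summable_of_lt_two_mul ha hb (fun i => ?_) hs hμ hν
      simpa [div_lt_iff₀ (hb i)] using hlt i
    | succ k ih =>
      intro a b μ ν _ _ ha hb hlt hs hμ hν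
      have hr : ∀ i, 0 < a i / b i := fun i => div_pos (ha i) (hb i)
      have hc : ∀ i, 0 < b i * √(a i / b i) := fun i => mul_pos (hb i) (Real.sqrt_pos.2 (hr i))
      have hac : ∀ i, a i / (b i * √(a i / b i)) = √(a i / b i) := fun i => by
        rw [← div_div, Real.div_sqrt]
      have hcb : ∀ i, b i * √(a i / b i) / b i = √(a i / b i) := fun i =>
        mul_div_cancel_left₀ _ (hb i).ne'
      have hsqrt_lt : ∀ i, √(a i / b i) < 2 ^ 2 ^ k := fun i => by
        rw [Real.sqrt_lt' (by positivity), ← pow_mul, ← pow_succ]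
        exact hlt i
      have hsqrt_sum : Summable fun i => (√(a i / b i) - 1) ^ 2 :=
        hs.of_nonneg_of_le (fun i => sq_nonneg _) fun i => sq_sqrt_sub_one_le (hr i).le
      exact (ih a _ μ _ ha hc (by simpa only [hac]) (by simpa only [hac]) hμ
        (infinitePi_gaussianReal_map_fin fun i => b i * √(a i / b i))).trans
        (ih _ b _ ν hc hb (by simpa only [hcb]) (by simpa only [hcb])
          (infinitePi_gaussianReal_map_fin _) hν)
  obtain ⟨T, hT⟩ := hs.tendsto_atTop_zero.bddAbove_range
  obtain ⟨k, hk⟩ := pow_unbounded_of_one_lt (T + 2) one_lt_two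
  refine key k a b μ ν ha hb (fun i => ?_) hs hμ hν
  have h1 : (a i / b i - 1) ^ 2 ≤ T := hT ⟨i, rfl⟩
  have h2 : (2 : ℝ) ^ k ≤ 2 ^ 2 ^ k := pow_le_pow_right₀ one_le_two k.lt_two_pow_self.le
  nlinarith [sq_nonneg (a i / b i - 1 - 1 / 2)]

theorem summable_div_sub_one_sq_of_summable {a b : ℕ → ℝ} (ha : ∀ i, 0 < a i)
    (hb : ∀ i, 0 < b i) (h : Summable fun i => ((a i - b i) / (a i + b i)) ^ 2) :
    Summable fun i => (a i / b i - 1) ^ 2 := by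
  refine .of_norm_bounded_eventually_nat (h.mul_left 16) ?_
  filter_upwards [h.tendsto_atTop_zero.eventually_lt_const (by norm_num : (0 : ℝ) < 1 / 4)]
    with i hi
  have hbi := hb i
  have hab : 0 < a i + b i := add_pos (ha i) hbi
  have hlt : a i < 3 * b i := by
    rw [div_pow, div_lt_iff₀ (by positivity)] at hi
    nlinarith [ha i]
  rw [Real.norm_of_nonneg (sq_nonneg _), div_sub_one hbi.ne', div_pow, div_pow,
    ← mul_div_assoc, div_le_div_iff₀ (by positivity) (by positivity), mul_comm 16, mul_assoc]
  refine mul_le_mul_of_nonneg_left ?_ (sq_nonneg _)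
  nlinarith [ha i]

theorem summable_div_sub_one_sq_symm {a b : ℕ → ℝ} (ha : ∀ i, 0 < a i) (hb : ∀ i, 0 < b i)
    (h : Summable fun i => (a i / b i - 1) ^ 2) : Summable fun i => (b i / a i - 1) ^ 2 := by
  refine summable_div_sub_one_sq_of_summable hb ha
    (h.of_nonneg_of_le (fun i => sq_nonneg _) fun i => ?_)
  have hai := ha i
  have hbi := hb i
  rw [div_sub_one hbi.ne', div_pow, div_pow, ← neg_sub, neg_sq]
  gcongr
  linarith

theorem tendsto_prod_affinity_zero {a b : ℕ → ℝ} (ha : ∀ i, 0 < a i) (hb : ∀ i, 0 < b i)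
    (h : ¬ Summable fun i => (a i / b i - 1) ^ 2) :
    Filter.Tendsto (fun n : ℕ => ∏ i : Fin n, ∫ x, √(gaussianPDFReal 0 (a i).toNNReal x *
      gaussianPDFReal 0 (b i).toNNReal x)) Filter.atTop (nhds 0) := by
  have hdiv : Filter.Tendsto
      (fun n => ∑ i ∈ Finset.range n, ((a i - b i) / (a i + b i)) ^ 2)
      Filter.atTop Filter.atTop :=
    (not_summable_iff_tendsto_nat_atTop_of_nonneg fun i => sq_nonneg _).1
      fun hs => h (summable_div_sub_one_sq_of_summable ha hb hs)
  have hnn : ∀ i, 0 ≤ ∫ x, √(gaussianPDFReal 0 (a i).toNNReal x *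
      gaussianPDFReal 0 (b i).toNNReal x) := fun i => integral_nonneg fun x => Real.sqrt_nonneg _
  have hlim : Filter.Tendsto (fun n =>
      Real.exp (-(∑ i ∈ Finset.range n, ((a i - b i) / (a i + b i)) ^ 2) / 4))
      Filter.atTop (nhds 0) :=
    Real.tendsto_exp_atBot.comp ((Filter.tendsto_neg_atTop_atBot.comp hdiv).atBot_div_const
      (by norm_num))
  refine squeeze_zero (fun n => Finset.prod_nonneg fun i _ => hnn i) (fun n => ?_) hlim
  rw [Fin.prod_univ_eq_prod_range (fun i => ∫ x, √(gaussianPDFReal 0 (a i).toNNReal x *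
    gaussianPDFReal 0 (b i).toNNReal x)), ← Finset.sum_neg_distrib, Finset.sum_div, Real.exp_sum]
  refine Finset.prod_le_prod (fun i _ => hnn i) fun i _ => ?_
  refine le_of_pow_le_pow_left₀ four_ne_zero (Real.exp_pos _).le ?_
  rw [integral_sqrt_gaussianPDFReal_mul_pow_four (ha i) (hb i), ← Real.exp_nat_mul]
  refine (Real.one_sub_le_exp_neg _).trans_eq ?_
  congr 1
  push_cast
  ring

theorem summable_of_absolutelyContinuous {a b : ℕ → ℝ} (ha : ∀ i, 0 < a i)
    (hb : ∀ i, 0 < b i)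
    {μ ν : Measure (ℕ → ℝ)} [IsProbabilityMeasure μ] [IsProbabilityMeasure ν]
    (hμ : ∀ n : ℕ, μ.map (fun x (i : Fin n) => x i)
      = Measure.pi (fun i : Fin n => gaussianReal 0 (a i).toNNReal))
    (hν : ∀ n : ℕ, ν.map (fun x (i : Fin n) => x i)
      = Measure.pi (fun i : Fin n => gaussianReal 0 (b i).toNNReal)) (h : μ ≪ ν) :
    Summable fun i => (a i / b i - 1) ^ 2 := by
  by_contra hs
  have hlim := tendsto_prod_affinity_zero ha hb hs
  choose B hB hBμ hBν using fun n : ℕ =>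
    exists_pi_gaussianReal_real_le_affinity (fun i : Fin n => ha i) (fun i => hb i)
  have hmeas : ∀ n, Measurable fun (x : ℕ → ℝ) (i : Fin n) => x i := fun n => by fun_prop
  have hA : ∀ n, MeasurableSet ((fun (x : ℕ → ℝ) (i : Fin n) => x i) ⁻¹' B n) := fun n =>
    hmeas n (hB n)
  simp_rw [← hμ, map_measureReal_apply (hmeas _) (hB _).compl, Set.preimage_compl] at hBμ
  simp_rw [← hν, map_measureReal_apply (hmeas _) (hB _)] at hBν
  have hν0 := squeeze_zero (fun n => measureReal_nonneg) hBν hlim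
  have hμ1 := squeeze_zero (fun n => measureReal_nonneg) hBμ hlim
  have hμ0 : Filter.Tendsto (fun n => μ ((fun (x : ℕ → ℝ) (i : Fin n) => x i) ⁻¹' B n))
      Filter.atTop (nhds 0) := by
    have := tendsto_setLIntegral_zero (μ := ν) (f := μ.rnDeriv ν)
      (Measure.lintegral_rnDeriv_lt_top μ ν).ne
      ((ENNReal.tendsto_toReal_zero_iff fun n => measure_ne_top _ _).1 hν0)
    simpa only [Measure.setLIntegral_rnDeriv h] using this
  have hμ0' := (ENNReal.tendsto_toReal_zero_iff fun n => measure_ne_top _ _).2 hμ0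
  have hsum := hμ0'.add hμ1
  simp only [← measureReal_def, probReal_add_probReal_compl (hA _), add_zero] at hsum
  exact one_ne_zero (tendsto_nhds_unique tendsto_const_nhds hsum)

end CountableProduct

/-- **Feldman–Hajek equivalence criterion** (Remark 2.2): the countable product
Gaussian measures `μ = ⨂ᵢ N(0, a i)` and `ν = ⨂ᵢ N(0, b i)` on `ℕ → ℝ`
(characterised by their finite-dimensional marginals) are equivalent if and only if
`∑ᵢ (a i / b i − 1)² < ∞`. -/
theorem feldmanHajek_equiv_iff_summable
    (a b : ℕ → ℝ) (ha : ∀ i, 0 < a i) (hb : ∀ i, 0 < b i)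
    (μ ν : Measure (ℕ → ℝ)) [IsProbabilityMeasure μ] [IsProbabilityMeasure ν]
    (hμ : ∀ n : ℕ, μ.map (fun x (i : Fin n) => x i)
      = Measure.pi (fun i : Fin n => gaussianReal 0 (a i).toNNReal))
    (hν : ∀ n : ℕ, ν.map (fun x (i : Fin n) => x i)
      = Measure.pi (fun i : Fin n => gaussianReal 0 (b i).toNNReal)) :
    (μ ≪ ν ∧ ν ≪ μ) ↔ Summable (fun i => (a i / b i - 1) ^ 2) :=
  ⟨fun h => summable_of_absolutelyContinuous ha hb hμ hν h.1, fun hs =>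
    ⟨absolutelyContinuous_of_summable ha hb hs hμ hν,
      absolutelyContinuous_of_summable hb ha (summable_div_sub_one_sq_symm ha hb hs) hν hμ⟩⟩
end

section
/- Let s > 0, let μ0 = gaussianReal 0 s be the Gaussian measure on ℝ with mean 0 and variance s, let Φ : ℝ → ℝ be measurable with ∫ exp(−Φ x) dμ0(x) = 1 and let μ1 = μ0.withDensity (fun x => ENNReal.ofReal (Real.exp (−Φ x))). Assume ∫ |Φ x| dμ1(x) < ∞ and ∫ x² dμ1(x) < ∞. Then for every m : ℝ and every d > 0, the Kullback–Leibler divergence of μ1 from the Gaussian measure gaussianReal m (d·s) satisfies klDiv μ1 (gaussianReal m (d·s)) = ENNReal.ofReal( −∫ Φ x dμ1(x) + (1/2)·Real.log d − (1/2)·(1/s − 1/(d·s))·∫ x² dμ1(x) − (m/(d·s))·∫ x dμ1(x) + m²/(2·d·s) ). -/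
open MeasureTheory ProbabilityTheory
open scoped ENNReal Classical

/-- The Kullback–Leibler divergence `∫ log (dμ/dν) dμ`, valued in `ℝ≥0∞`. -/
noncomputable def klDiv {α : Type*} [MeasurableSpace α] (μ ν : Measure α) : ℝ≥0∞ :=
  if μ ≪ ν ∧ Integrable (llr μ ν) μ then ENNReal.ofReal (∫ x, llr μ ν x ∂μ) else ∞

/-- Two nondegenerate real Gaussian measures have an explicit relative density. -/
lemma gaussianReal_eq_withDensity_gaussianReal (m₁ m₂ : ℝ) {v₁ v₂ : NNReal}
    (hv₁ : v₁ ≠ 0) (hv₂ : v₂ ≠ 0) :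
    gaussianReal m₁ v₁ = (gaussianReal m₂ v₂).withDensity (fun x => ENNReal.ofReal
      (Real.exp ((1 / 2) * Real.log (v₂ / v₁) - (x - m₁) ^ 2 / (2 * v₁)
        + (x - m₂) ^ 2 / (2 * v₂)))) := by
  have h₁ : (0 : ℝ) < v₁ := by positivity
  have h₂ : (0 : ℝ) < v₂ := by positivity
  rw [gaussianReal_of_var_ne_zero _ hv₁, gaussianReal_of_var_ne_zero _ hv₂,
    ← withDensity_mul _ (measurable_gaussianPDF _ _) (by fun_prop)]
  congr 1
  ext1 x
  have hsqrt : Real.exp ((1 / 2) * Real.log (v₂ / v₁)) = √v₂ / √v₁ := by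
    rw [← Real.sqrt_div h₂.le, Real.sqrt_eq_rpow, Real.rpow_def_of_pos (by positivity), mul_comm]
  have hexp : Real.exp (-(x - m₂) ^ 2 / (2 * v₂)) * Real.exp ((x - m₂) ^ 2 / (2 * v₂)) = 1 := by
    rw [← Real.exp_add, ← Real.exp_zero]
    congr 1
    ring
  rw [Pi.mul_apply, gaussianPDF, gaussianPDF,
    ← ENNReal.ofReal_mul (gaussianPDFReal_nonneg _ _ _)]
  congr 1
  rw [gaussianPDFReal, gaussianPDFReal, Real.exp_add,
    sub_eq_add_neg ((1 / 2) * Real.log (v₂ / v₁) : ℝ), Real.exp_add, hsqrt,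
    Real.sqrt_mul (by positivity), Real.sqrt_mul (by positivity) (v₂ : ℝ), ← neg_div]
  have hs₂ : √(v₂ : ℝ) ≠ 0 := by positivity
  calc _ = (√(2 * Real.pi) * √v₁)⁻¹ * Real.exp (-(x - m₁) ^ 2 / (2 * v₁)) * 1 := (mul_one _).symm
    _ = _ := by
      rw [← hexp]
      field_simp

/-- The log-likelihood ratio of a measure with exponential density is the exponent. -/
lemma llr_withDensity_exp {α : Type*} [MeasurableSpace α] (ν : Measure α) [SigmaFinite ν]
    {g : α → ℝ} (hg : Measurable g) :
    llr (ν.withDensity fun x => ENNReal.ofReal (Real.exp (g x))) ν =ᵐ[ν] g := by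
  filter_upwards [Measure.rnDeriv_withDensity ν (f := fun x => ENNReal.ofReal (Real.exp (g x)))
    (by fun_prop)] with x hx
  rw [llr, hx, ENNReal.toReal_ofReal (Real.exp_nonneg _), Real.log_exp]

/-- Explicit Kullback–Leibler divergence formula (Section 2.3 of the paper, in one
dimension) for a target `μ1 = exp(−Φ) dμ0` with centred Gaussian base `μ0 = N(0, s)`,
against the Gaussian `N(m, d·s)`. -/
theorem klDiv_formula_one_dim
    (s : ℝ) (hs : 0 < s) (Φ : ℝ → ℝ) (hΦ : Measurable Φ)
    (hnorm : ∫ x, Real.exp (-Φ x) ∂(gaussianReal 0 s.toNNReal) = 1)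
    (μ1 : Measure ℝ)
    (hμ1 : μ1 = (gaussianReal 0 s.toNNReal).withDensity
      (fun x => ENNReal.ofReal (Real.exp (-Φ x))))
    (hΦint : Integrable Φ μ1)
    (hx2int : Integrable (fun x => x ^ 2) μ1)
    (m d : ℝ) (hd : 0 < d) :
    klDiv μ1 (gaussianReal m (d * s).toNNReal)
      = ENNReal.ofReal (-(∫ x, Φ x ∂μ1) + (1 / 2) * Real.log d
          - (1 / 2) * (1 / s - 1 / (d * s)) * (∫ x, x ^ 2 ∂μ1)
          - (m / (d * s)) * (∫ x, x ∂μ1) + m ^ 2 / (2 * d * s)) := by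
  have hs' : s.toNNReal ≠ 0 := by simpa using hs
  have hds : 0 < d * s := mul_pos hd hs
  have hds' : (d * s).toNNReal ≠ 0 := by simpa using hds
  set ν := gaussianReal m (d * s).toNNReal
  set g : ℝ → ℝ := fun x => -Φ x + (1 / 2) * Real.log d
    - (1 / 2) * (1 / s - 1 / (d * s)) * x ^ 2 - (m / (d * s)) * x + m ^ 2 / (2 * d * s) with hg
  have hgm : Measurable g := by fun_prop
  have hμν : μ1 = ν.withDensity (fun x => ENNReal.ofReal (Real.exp (g x))) := by
    rw [hμ1, gaussianReal_eq_withDensity_gaussianReal 0 m hs' hds',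
      ← withDensity_mul _ (by fun_prop) (by fun_prop)]
    congr 1
    ext1 x
    rw [Pi.mul_apply, ← ENNReal.ofReal_mul (Real.exp_nonneg _), ← Real.exp_add,
      Real.coe_toNNReal _ hs.le, Real.coe_toNNReal _ hds.le, mul_div_cancel_right₀ _ hs.ne']
    congr 2
    simp only [hg]
    field_simp
    ring
  have hac : μ1 ≪ ν := hμν ▸ withDensity_absolutelyContinuous _ _
  have hllr : llr μ1 ν =ᵐ[μ1] g := by
    refine hac.ae_le ?_
    rw [hμν]
    exact llr_withDensity_exp ν hgm
  have hprob : IsProbabilityMeasure μ1 := by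
    have hint : Integrable (fun x => Real.exp (-Φ x)) (gaussianReal 0 s.toNNReal) :=
      Integrable.of_integral_ne_zero (by simp [hnorm])
    constructor
    rw [hμ1, withDensity_apply _ MeasurableSet.univ, Measure.restrict_univ,
      ← ofReal_integral_eq_lintegral_ofReal hint (ae_of_all _ fun _ => Real.exp_nonneg _),
      hnorm, ENNReal.ofReal_one]
  have hxint : Integrable (fun x : ℝ => x) μ1 :=
    ((memLp_two_iff_integrable_sq (by fun_prop)).2 hx2int).integrable one_le_two
  have i₁ : Integrable (fun x => -Φ x + (1 / 2) * Real.log d) μ1 :=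
    hΦint.neg.add (integrable_const _)
  have i₂ := hx2int.const_mul ((1 / 2) * (1 / s - 1 / (d * s)))
  have i₃ := hxint.const_mul (m / (d * s))
  have i₁₂ : Integrable (fun x => -Φ x + (1 / 2) * Real.log d
      - (1 / 2) * (1 / s - 1 / (d * s)) * x ^ 2) μ1 := i₁.sub i₂
  have i₁₂₃ : Integrable (fun x => -Φ x + (1 / 2) * Real.log d
      - (1 / 2) * (1 / s - 1 / (d * s)) * x ^ 2 - (m / (d * s)) * x) μ1 := i₁₂.sub i₃
  have hgint : Integrable g μ1 := i₁₂₃.add (integrable_const _)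
  rw [klDiv, if_pos ⟨hac, hgint.congr hllr.symm⟩, integral_congr_ae hllr]
  congr 1
  simp only [hg]
  rw [integral_add i₁₂₃ (integrable_const _), integral_sub i₁₂ i₃, integral_sub i₁ i₂,
    integral_add hΦint.fun_neg (integrable_const _), integral_neg, integral_const_mul,
    integral_const_mul, integral_const_mul (m / (d * s))]
  simp
end

section
/- Let m : Fin n → ℝ, τ : Fin n → ℝ with τ i > 0, Ψ = N(m, τ), β ∈ [0,1] and c_β = 1 − Real.sqrt (1 − β²). Then the pushforward of the product measure Ψ.prod η under the map (u, ξ) ↦ (fun i => (1 − c_β) · u i + c_β · m i + β · Real.sqrt (τ i) · ξ i) equals Ψ. That is, the (adapted-measure) preconditioned Crank–Nicolson proposal leaves its Gaussian base measure invariant. -/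
open MeasureTheory ProbabilityTheory
open scoped NNReal

theorem map_affine_comb_gaussianReal_prod (μ₁ μ₂ : ℝ) (v₁ v₂ : ℝ≥0) (a b c : ℝ) :
    ((gaussianReal μ₁ v₁).prod (gaussianReal μ₂ v₂)).map
        (fun q : ℝ × ℝ => a * q.1 + b + c * q.2)
      = gaussianReal (a * μ₁ + b + c * μ₂)
          (.mk (a ^ 2) (sq_nonneg a) * v₁ + .mk (c ^ 2) (sq_nonneg c) * v₂) := by
  have hX : (gaussianReal μ₁ v₁).map (fun x => a * x + b)
      = gaussianReal (a * μ₁ + b) (.mk (a ^ 2) (sq_nonneg a) * v₁) := by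
    rw [← gaussianReal_map_add_const, ← gaussianReal_map_const_mul,
      Measure.map_map (by fun_prop) (by fun_prop)]
    rfl
  rw [← gaussianReal_conv_gaussianReal, ← hX, ← gaussianReal_map_const_mul, Measure.conv,
    Measure.map_prod_map _ _ (by fun_prop) (by fun_prop),
    Measure.map_map (by fun_prop) (by fun_prop)]
  rfl

/-- The (adapted-measure) preconditioned Crank–Nicolson proposal
`(u, ξ) ↦ (1 − c_β) u + c_β m + β √τ ξ`, with `c_β = 1 − √(1 − β²)`, leaves its Gaussian
base measure `Ψ = N(m, τ)` invariant: the pushforward of `Ψ ⊗ N(0, I)` under the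
proposal map is `Ψ`. -/
theorem pCN_proposal_invariance
    (n : ℕ) (m τ : Fin n → ℝ) (hτ : ∀ i, 0 < τ i)
    (β : ℝ) (hβ : β ∈ Set.Icc (0 : ℝ) 1) :
    Measure.map
      (fun p : (Fin n → ℝ) × (Fin n → ℝ) => fun i =>
        (1 - (1 - Real.sqrt (1 - β ^ 2))) * p.1 i
          + (1 - Real.sqrt (1 - β ^ 2)) * m i
          + β * Real.sqrt (τ i) * p.2 i)
      ((Measure.pi (fun i => gaussianReal (m i) (τ i).toNNReal)).prod
        (Measure.pi (fun _ : Fin n => gaussianReal 0 1)))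
    = Measure.pi (fun i => gaussianReal (m i) (τ i).toNNReal) := by
  have hprod := measurePreserving_arrowProdEquivProdArrow ℝ ℝ (Fin n)
    (fun i => gaussianReal (m i) (τ i).toNNReal) (fun _ => gaussianReal 0 1)
  have hcoord (i : Fin n) :
      ((gaussianReal (m i) (τ i).toNNReal).prod (gaussianReal 0 1)).map
        (fun q : ℝ × ℝ => (1 - (1 - Real.sqrt (1 - β ^ 2))) * q.1
          + (1 - Real.sqrt (1 - β ^ 2)) * m i + β * Real.sqrt (τ i) * q.2)
        = gaussianReal (m i) (τ i).toNNReal := by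
    rw [map_affine_comb_gaussianReal_prod]
    congr 1
    · ring
    · have hβ' : 0 ≤ 1 - β ^ 2 := by nlinarith [hβ.1, hβ.2]
      ext
      push_cast
      rw [Real.coe_toNNReal _ (hτ i).le]
      simp only [sub_sub_cancel, mul_pow, Real.sq_sqrt hβ', Real.sq_sqrt (hτ i).le]
      ring
  rw [← hprod.map_eq, Measure.map_map (by fun_prop) hprod.measurable]
  calc _ = (Measure.pi fun i =>
        (gaussianReal (m i) (τ i).toNNReal).prod (gaussianReal 0 1)).map
          (fun x i => (1 - (1 - Real.sqrt (1 - β ^ 2))) * (x i).1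
          + (1 - Real.sqrt (1 - β ^ 2)) * m i + β * Real.sqrt (τ i) * (x i).2) := rfl
    _ = _ := by
      have (i : Fin n) : SigmaFinite
          (((gaussianReal (m i) (τ i).toNNReal).prod (gaussianReal 0 1)).map
            (fun q : ℝ × ℝ => (1 - (1 - Real.sqrt (1 - β ^ 2))) * q.1
              + (1 - Real.sqrt (1 - β ^ 2)) * m i + β * Real.sqrt (τ i) * q.2)) := by
        rw [hcoord]; infer_instance
      rw [Measure.pi_map_pi (f := fun i (q : ℝ × ℝ) =>
        (1 - (1 - Real.sqrt (1 - β ^ 2))) * q.1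
          + (1 - Real.sqrt (1 - β ^ 2)) * m i + β * Real.sqrt (τ i) * q.2)
          (fun i => by fun_prop)]
      simp_rw [hcoord]
end

section
/- Let m : Fin n → ℝ, τ : Fin n → ℝ with τ i > 0, Ψ = N(m, τ), β ∈ [0,1] and c_β = 1 − Real.sqrt (1 − β²). Define ν⋆ as the pushforward of Ψ.prod η under the map (u, ξ) ↦ (u, fun i => (1 − c_β) · u i + c_β · m i + β · Real.sqrt (τ i) · ξ i), a measure on E × E. Then ν⋆ is exchangeable: Measure.map Prod.swap ν⋆ = ν⋆. (This is the symmetry ν⋆^⊥ = ν⋆ underlying the Crank–Nicolson acceptance ratios.) -/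
open MeasureTheory ProbabilityTheory

/-- The joint law of `(u, ρ u + (1 - ρ) m + b ξ)`, with `u ∼ N(m, v)` and `ξ ∼ N(0, 1)`
independent, is symmetric whenever `b ^ 2 = (1 - ρ ^ 2) v`. -/
theorem map_swap_autoregressive_gaussianReal (m : ℝ) (v : NNReal) (ρ b : ℝ)
    (hb : b ^ 2 = (1 - ρ ^ 2) * v) :
    (((gaussianReal m v).prod (gaussianReal 0 1)).map
        (fun p : ℝ × ℝ => (p.1, ρ * p.1 + (1 - ρ) * m + b * p.2))).map Prod.swap
      = ((gaussianReal m v).prod (gaussianReal 0 1)).map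
        (fun p : ℝ × ℝ => (p.1, ρ * p.1 + (1 - ρ) * m + b * p.2)) := by
  have key (s t : ℝ) :
      ∫ p : ℝ × ℝ, Complex.exp
          (((s * p.1 + t * (ρ * p.1 + (1 - ρ) * m + b * p.2) : ℝ) : ℂ) * Complex.I)
          ∂(gaussianReal m v).prod (gaussianReal 0 1)
        = Complex.exp ((s + t) * m * Complex.I
          - v * (s ^ 2 + 2 * ρ * s * t + t ^ 2) / 2) := by
    have hsplit (p : ℝ × ℝ) : Complex.exp
        (((s * p.1 + t * (ρ * p.1 + (1 - ρ) * m + b * p.2) : ℝ) : ℂ) * Complex.I)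
        = Complex.exp (t * (1 - ρ) * m * Complex.I)
          * (Complex.exp ((s + t * ρ : ℝ) * p.1 * Complex.I)
            * Complex.exp ((t * b : ℝ) * p.2 * Complex.I)) := by
      rw [← Complex.exp_add, ← Complex.exp_add]
      congr 1
      push_cast
      ring
    have hbc : (b : ℂ) ^ 2 = (1 - ρ ^ 2) * (v : ℝ) := by exact_mod_cast congrArg Complex.ofReal hb
    simp_rw [hsplit]
    rw [integral_const_mul, integral_prod_mul
      (fun x : ℝ => Complex.exp ((s + t * ρ : ℝ) * x * Complex.I))
      (fun x : ℝ => Complex.exp ((t * b : ℝ) * x * Complex.I)),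
      ← charFun_apply_real, ← charFun_apply_real, charFun_gaussianReal, charFun_gaussianReal,
      ← Complex.exp_add, ← Complex.exp_add]
    congr 1
    push_cast
    linear_combination (-(t : ℂ) ^ 2 / 2) * hbc
  have hmeas : Measurable (fun p : ℝ × ℝ => (p.1, ρ * p.1 + (1 - ρ) * m + b * p.2)) := by
    fun_prop
  have hL (L : StrongDual ℝ (ℝ × ℝ)) : ∃ s t : ℝ, ∀ x y, L (x, y) = s * x + t * y := by
    refine ⟨L (1, 0), L (0, 1), fun x y => ?_⟩
    have h : (x, y) = x • ((1, 0) : ℝ × ℝ) + y • ((0, 1) : ℝ × ℝ) := by simp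
    rw [h, map_add, map_smul, map_smul, smul_eq_mul, smul_eq_mul, mul_comm x, mul_comm y]
  refine Measure.ext_of_charFunDual (funext fun L => ?_)
  obtain ⟨s, t, hst⟩ := hL L
  rw [Measure.map_map measurable_swap hmeas, charFunDual_apply, charFunDual_apply,
    integral_map (measurable_swap.comp hmeas).aemeasurable (by fun_prop),
    integral_map hmeas.aemeasurable (by fun_prop)]
  simp only [Function.comp_apply, Prod.swap_prod_mk]
  simp_rw [hst, fun p : ℝ × ℝ => add_comm (s * (ρ * p.1 + (1 - ρ) * m + b * p.2))]
  rw [key, key]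
  congr 1
  ring

/-- A product of symmetric joint laws is symmetric. -/
theorem map_swap_pi_of_map_swap {ι α β : Type*} [Fintype ι] [MeasurableSpace α]
    [MeasurableSpace β] (μ : ι → Measure α) (ν : ι → Measure β)
    [∀ i, IsProbabilityMeasure (μ i)] [∀ i, IsProbabilityMeasure (ν i)]
    (f : ι → α × β → α × α) (hf : ∀ i, Measurable (f i))
    (h : ∀ i, (((μ i).prod (ν i)).map (f i)).map Prod.swap = ((μ i).prod (ν i)).map (f i)) :
    (((Measure.pi μ).prod (Measure.pi ν)).map
        (fun p => (fun i => (f i (p.1 i, p.2 i)).1, fun i => (f i (p.1 i, p.2 i)).2))).map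
        Prod.swap
      = ((Measure.pi μ).prod (Measure.pi ν)).map
        (fun p => (fun i => (f i (p.1 i, p.2 i)).1, fun i => (f i (p.1 i, p.2 i)).2)) := by
  have (i : ι) : IsProbabilityMeasure (((μ i).prod (ν i)).map (f i)) :=
    Measure.isProbabilityMeasure_map (hf i).aemeasurable
  rw [← (measurePreserving_arrowProdEquivProdArrow α β ι μ ν).map_eq]
  have hpi : (Measure.pi fun i => (μ i).prod (ν i)).map (fun x i => f i (x i))
      = Measure.pi fun i => ((μ i).prod (ν i)).map (f i) :=
    Measure.pi_map_pi fun i => (hf i).aemeasurable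
  have hswap : (Measure.pi fun i => ((μ i).prod (ν i)).map (f i)).map
      (fun x i => (x i).swap) = Measure.pi fun i => ((μ i).prod (ν i)).map (f i) := by
    rw [Measure.pi_map_pi (fun i => measurable_swap.aemeasurable)]
    simp_rw [h]
  have hunzip : Measurable (fun x : ι → α × α => ((fun i => (x i).1), fun i => (x i).2)) := by
    fun_prop
  have hcomp : Measurable (fun (x : ι → α × β) i => f i (x i)) := by fun_prop
  have hmap : ((Measure.pi fun i => (μ i).prod (ν i)).map
        (MeasurableEquiv.arrowProdEquivProdArrow α β ι)).map
        (fun p => (fun i => (f i (p.1 i, p.2 i)).1, fun i => (f i (p.1 i, p.2 i)).2))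
      = (Measure.pi fun i => ((μ i).prod (ν i)).map (f i)).map
        (fun x => ((fun i => (x i).1), fun i => (x i).2)) := by
    rw [← hpi, Measure.map_map hunzip hcomp, Measure.map_map (by fun_prop) (by fun_prop)]
    rfl
  rw [hmap, Measure.map_map measurable_swap hunzip]
  nth_rewrite 2 [← hswap]
  rw [Measure.map_map hunzip (by fun_prop)]
  rfl

/-- Exchangeability of the Crank–Nicolson joint reference measure: with Gaussian base
measure `Ψ = N(m, τ)`, the joint law `ν⋆` of `(u, v)`, where `u ∼ Ψ` and
`v = (1 − c_β) u + c_β m + β √τ ξ` with `ξ ∼ N(0, I)` independent, is invariant under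
swapping the two coordinates, i.e. `ν⋆^⊥ = ν⋆`. -/
theorem pCN_reference_measure_exchangeable
    (n : ℕ) (m τ : Fin n → ℝ) (hτ : ∀ i, 0 < τ i)
    (β : ℝ) (hβ : β ∈ Set.Icc (0 : ℝ) 1)
    (νstar : Measure ((Fin n → ℝ) × (Fin n → ℝ)))
    (hνstar : νstar = Measure.map
      (fun p : (Fin n → ℝ) × (Fin n → ℝ) =>
        (p.1, fun i =>
          (1 - (1 - Real.sqrt (1 - β ^ 2))) * p.1 i
            + (1 - Real.sqrt (1 - β ^ 2)) * m i
            + β * Real.sqrt (τ i) * p.2 i))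
      ((Measure.pi (fun i => gaussianReal (m i) (τ i).toNNReal)).prod
        (Measure.pi (fun _ : Fin n => gaussianReal 0 1)))) :
    Measure.map Prod.swap νstar = νstar := by
  subst hνstar
  have hsq : Real.sqrt (1 - β ^ 2) ^ 2 = 1 - β ^ 2 :=
    Real.sq_sqrt (by nlinarith [hβ.1, hβ.2])
  have h := map_swap_pi_of_map_swap (fun i => gaussianReal (m i) (τ i).toNNReal)
    (fun _ => gaussianReal 0 1)
    (fun i (p : ℝ × ℝ) => (p.1, Real.sqrt (1 - β ^ 2) * p.1
      + (1 - Real.sqrt (1 - β ^ 2)) * m i + β * Real.sqrt (τ i) * p.2))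
    (fun i => by fun_prop)
    (fun i => map_swap_autoregressive_gaussianReal _ _ _ _ (by
      rw [mul_pow, hsq, Real.sq_sqrt (hτ i).le, Real.coe_toNNReal _ (hτ i).le]
      ring))
  simpa only [sub_sub_cancel] using h
end

section
/- Let β ∈ (0,1). Define ν as the pushforward of μ1.prod η under the map (u, ξ) ↦ (u, fun i => Real.sqrt (1 − β²) · u i + β · Real.sqrt (σ i) · ξ i), and let ν^⊥ = Measure.map Prod.swap ν. Then ν^⊥ and ν are equivalent, and the Radon–Nikodym derivative satisfies, for ν-almost every (u, v), (dν^⊥/dν)(u, v) = Real.exp (Φ u − Φ v). Consequently the preconditioned Crank–Nicolson Metropolis–Hastings acceptance probability is min(1, exp(Φ(u) − Φ(v))). -/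
open MeasureTheory ProbabilityTheory

theorem map_withDensity_comp {α γ : Type*} [MeasurableSpace α] [MeasurableSpace γ]
    (μ : Measure α) {T : α → γ} (hT : Measurable T) {f : γ → ENNReal} (hf : Measurable f) :
    (μ.withDensity fun x => f (T x)).map T = (μ.map T).withDensity f := by
  ext s hs
  rw [Measure.map_apply hT hs, withDensity_apply _ (hT hs), withDensity_apply _ hs,
    setLIntegral_map hs hf hT]

theorem charFunDual_pi_gaussianReal {ι : Type*} [Fintype ι] [DecidableEq ι] (v : ι → NNReal)
    (L : StrongDual ℝ (ι → ℝ)) :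
    charFunDual (Measure.pi fun i => gaussianReal 0 (v i)) L =
      Complex.exp ((-(∑ i, v i * L (Pi.single i 1) ^ 2) / 2 : ℝ)) := by
  rw [charFunDual_pi]
  have h (i : ι) : charFunDual (gaussianReal 0 (v i)) (L.comp (.single ℝ (fun _ => ℝ) i)) =
      Complex.exp ((-(v i * L (Pi.single i 1) ^ 2) / 2 : ℝ)) := by
    rw [charFunDual_eq_charFun_map_one, gaussianReal_map_continuousLinearMap, charFun_gaussianReal]
    congr 1
    simp [sq_nonneg]
    ring
  simp_rw [h]
  rw [← Complex.exp_sum, ← Complex.ofReal_sum, ← Finset.sum_div, Finset.sum_neg_distrib]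

/-- The pCN proposal `(u, ξ) ↦ (u, √(1 - β²) u + β √σ ξ)` as a continuous linear map. -/
noncomputable def pCNMap {ι : Type*} [Fintype ι] (σ : ι → ℝ) (β : ℝ) :
    (ι → ℝ) × (ι → ℝ) →L[ℝ] (ι → ℝ) × (ι → ℝ) :=
  (ContinuousLinearMap.fst ℝ _ _).prod (ContinuousLinearMap.pi fun i =>
    Real.sqrt (1 - β ^ 2) • (ContinuousLinearMap.proj i).comp (ContinuousLinearMap.fst ℝ _ _) +
      (β * Real.sqrt (σ i)) • (ContinuousLinearMap.proj i).comp (ContinuousLinearMap.snd ℝ _ _))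

theorem pCNMap_apply {ι : Type*} [Fintype ι] (σ : ι → ℝ) (β : ℝ) (p : (ι → ℝ) × (ι → ℝ)) :
    pCNMap σ β p =
      (p.1, fun i => Real.sqrt (1 - β ^ 2) * p.1 i + β * Real.sqrt (σ i) * p.2 i) := rfl

/-- The characteristic function of the joint law of the prior and its pCN proposal. -/
theorem charFunDual_map_pCNMap {ι : Type*} [Fintype ι] [DecidableEq ι] (σ : ι → ℝ)
    (hσ : ∀ i, 0 ≤ σ i) (β : ℝ) (hβ : β ^ 2 ≤ 1) (L : StrongDual ℝ ((ι → ℝ) × (ι → ℝ))) :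
    charFunDual (((Measure.pi fun i => gaussianReal 0 (σ i).toNNReal).prod
        (Measure.pi fun _ : ι => gaussianReal 0 1)).map (pCNMap σ β)) L =
      Complex.exp ((-(∑ i, σ i * (L (Pi.single i 1, 0) ^ 2 + L (0, Pi.single i 1) ^ 2 +
        2 * Real.sqrt (1 - β ^ 2) * L (Pi.single i 1, 0) * L (0, Pi.single i 1))) / 2 : ℝ)) := by
  rw [charFunDual_map, charFunDual_prod, charFunDual_pi_gaussianReal, charFunDual_pi_gaussianReal,
    ← Complex.exp_add, ← Complex.ofReal_add, ← add_div, ← neg_add, ← Finset.sum_add_distrib]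
  congr 4
  refine Finset.sum_congr rfl fun i _ => ?_
  have h1 : pCNMap σ β (Pi.single i 1, 0) =
      (Pi.single i 1, 0) + Real.sqrt (1 - β ^ 2) • (0, Pi.single i 1) := by
    ext j <;> by_cases h : j = i <;> simp [pCNMap_apply, Pi.single_apply, h]
  have h2 : pCNMap σ β (0, Pi.single i 1) = (β * Real.sqrt (σ i)) • (0, Pi.single i 1) := by
    ext j <;> by_cases h : j = i <;> simp [pCNMap_apply, Pi.single_apply, h]
  simp only [ContinuousLinearMap.comp_apply, ContinuousLinearMap.inl_apply,
    ContinuousLinearMap.inr_apply, h1, h2, map_add, map_smul, smul_eq_mul, NNReal.coe_one,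
    Real.coe_toNNReal _ (hσ i), mul_pow, Real.sq_sqrt (hσ i)]
  have hs := Real.sq_sqrt (sub_nonneg.2 hβ)
  linear_combination σ i * L (0, Pi.single i 1) ^ 2 * hs

/-- The pCN proposal is reversible with respect to the Gaussian prior. -/
theorem map_swap_map_pCNMap {ι : Type*} [Fintype ι] (σ : ι → ℝ) (hσ : ∀ i, 0 ≤ σ i)
    (β : ℝ) (hβ : β ^ 2 ≤ 1) :
    (((Measure.pi fun i => gaussianReal 0 (σ i).toNNReal).prod
        (Measure.pi fun _ : ι => gaussianReal 0 1)).map (pCNMap σ β)).map Prod.swap =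
      ((Measure.pi fun i => gaussianReal 0 (σ i).toNNReal).prod
        (Measure.pi fun _ : ι => gaussianReal 0 1)).map (pCNMap σ β) := by
  classical
  refine Measure.ext_of_charFunDual (funext fun L => ?_)
  have h := charFunDual_map (μ := ((Measure.pi fun i => gaussianReal 0 (σ i).toNNReal).prod
    (Measure.pi fun _ : ι => gaussianReal 0 1)).map (pCNMap σ β))
    (ContinuousLinearEquiv.prodComm ℝ (ι → ℝ) (ι → ℝ)).toContinuousLinearMap L
  refine h.trans ?_
  rw [charFunDual_map_pCNMap σ hσ β hβ, charFunDual_map_pCNMap σ hσ β hβ]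
  congr 4
  refine Finset.sum_congr rfl fun i _ => ?_
  simp [-mul_eq_mul_left_iff]
  ring

/-- The preconditioned Crank–Nicolson Metropolis–Hastings ratio: with target
`μ1 = exp(−Φ) dμ0`, prior `μ0 = N(0, σ)`, and pCN joint law `ν` of `(u, v)` where
`u ∼ μ1` and `v = √(1 − β²) u + β √σ ξ`, the swapped measure `ν^⊥` is equivalent to `ν`
and `(dν^⊥/dν)(u, v) = exp(Φ(u) − Φ(v))` for `ν`-a.e. `(u, v)`. -/
theorem pCN_metropolis_hastings_ratio
    (n : ℕ) (σ : Fin n → ℝ) (hσ : ∀ i, 0 < σ i)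
    (Φ : (Fin n → ℝ) → ℝ) (hΦ : Measurable Φ)
    (hnorm : ∫ u, Real.exp (-Φ u)
      ∂(Measure.pi (fun i => gaussianReal 0 (σ i).toNNReal)) = 1)
    (μ1 : Measure (Fin n → ℝ))
    (hμ1 : μ1 = (Measure.pi (fun i => gaussianReal 0 (σ i).toNNReal)).withDensity
      (fun u => ENNReal.ofReal (Real.exp (-Φ u))))
    (β : ℝ) (hβ : β ∈ Set.Ioo (0 : ℝ) 1)
    (ν : Measure ((Fin n → ℝ) × (Fin n → ℝ)))
    (hν : ν = Measure.map
      (fun p : (Fin n → ℝ) × (Fin n → ℝ) =>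
        (p.1, fun i => Real.sqrt (1 - β ^ 2) * p.1 i + β * Real.sqrt (σ i) * p.2 i))
      (μ1.prod (Measure.pi (fun _ : Fin n => gaussianReal 0 1)))) :
    (Measure.map Prod.swap ν ≪ ν ∧ ν ≪ Measure.map Prod.swap ν) ∧
      ∀ᵐ p ∂ν, (Measure.map Prod.swap ν).rnDeriv ν p
        = ENNReal.ofReal (Real.exp (Φ p.1 - Φ p.2)) := by
  set μ0 := Measure.pi fun i => gaussianReal 0 (σ i).toNNReal
  set ν0 := (μ0.prod (Measure.pi fun _ : Fin n => gaussianReal 0 1)).map (pCNMap σ β)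
  have hβ2 : β ^ 2 ≤ 1 := pow_le_one₀ hβ.1.le hβ.2.le
  have hswap : ν0.map Prod.swap = ν0 := map_swap_map_pCNMap σ (fun i => (hσ i).le) β hβ2
  have hν1 : ν = ν0.withDensity fun p => ENNReal.ofReal (Real.exp (-Φ p.1)) := by
    rw [hν, hμ1, prod_withDensity_left (by fun_prop)]
    exact map_withDensity_comp _ (pCNMap σ β).measurable
      (f := fun p => ENNReal.ofReal (Real.exp (-Φ p.1))) (by fun_prop)
  have hν2 : ν.map Prod.swap = ν0.withDensity fun p => ENNReal.ofReal (Real.exp (-Φ p.2)) := by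
    conv_rhs => rw [← hswap]
    rw [hν1]
    exact map_withDensity_comp _ measurable_swap
      (f := fun p => ENNReal.ofReal (Real.exp (-Φ p.2))) (by fun_prop)
  have hν3 : ν.map Prod.swap =
      ν.withDensity fun p => ENNReal.ofReal (Real.exp (Φ p.1 - Φ p.2)) := by
    rw [hν2, hν1, ← withDensity_mul _ (by fun_prop) (by fun_prop)]
    congr 1
    ext p
    rw [Pi.mul_apply, ← ENNReal.ofReal_mul (Real.exp_pos _).le, ← Real.exp_add]
    congr 2
    ring
  have hfin : SigmaFinite ν := by
    rw [hν1]
    exact SigmaFinite.withDensity_of_ne_top (by simp)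
  rw [hν3]
  refine ⟨⟨withDensity_absolutelyContinuous _ _, withDensity_absolutelyContinuous' (by fun_prop) ?_⟩,
    Measure.rnDeriv_withDensity ν (by fun_prop)⟩
  exact ae_of_all _ fun p => (ENNReal.ofReal_pos.2 (Real.exp_pos _)).ne'
end

section
/- Suppose Φ is continuously differentiable with partial derivatives ∂ᵢΦ. Let δ ∈ (0,2), β² = 8δ/(2+δ)², and c_β = 1 − Real.sqrt (1 − β²). Define the preconditioned Crank–Nicolson Langevin joint measure ν_L as the pushforward of μ1.prod η under (u, ξ) ↦ (u, fun i => Real.sqrt (1 − β²) · u i − c_β · σ i · ∂ᵢΦ(u) + β · Real.sqrt (σ i) · ξ i), and the reference measure ν⋆ as the pushforward of μ0.prod η under (u, ξ) ↦ (u, fun i => Real.sqrt (1 − β²) · u i + β · Real.sqrt (σ i) · ξ i). Then ν_L ≪ ν⋆ and, for ν⋆-almost every (u, v), (dν_L/dν⋆)(u, v) = Real.exp (−ρ(u, v)) where ρ(u, v) = Φ(u) + (δ/4) · ∑ᵢ σ i · (∂ᵢΦ(u))² + (1/2) · ∑ᵢ (v i − u i) · ∂ᵢΦ(u) + (δ/4)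 · ∑ᵢ (v i + u i) · ∂ᵢΦ(u). -/
open MeasureTheory ProbabilityTheory

namespace MeasureTheory

lemma Measure.pi_withDensity {ι : Type*} [Fintype ι] {X : ι → Type*}
    {mX : ∀ i, MeasurableSpace (X i)} (μ : ∀ i, Measure (X i)) [∀ i, IsProbabilityMeasure (μ i)]
    {f : ∀ i, X i → ENNReal} (hf : ∀ i, Measurable (f i))
    [∀ i, SigmaFinite ((μ i).withDensity (f i))] :
    Measure.pi (fun i => (μ i).withDensity (f i))
      = (Measure.pi μ).withDensity (fun x => ∏ i, f i (x i)) := by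
  refine Measure.pi_eq fun s hs => ?_
  have hmeas (i : ι) : Measurable ((s i).indicator (f i)) := (hf i).indicator (hs i)
  have hind : (Set.univ.pi s).indicator (fun x => ∏ i, f i (x i))
      = fun x => ∏ i, (s i).indicator (f i) (x i) := by
    ext x
    by_cases hx : x ∈ Set.univ.pi s
    · rw [Set.indicator_of_mem hx]
      exact Finset.prod_congr rfl fun i _ => (Set.indicator_of_mem (hx i trivial) _).symm
    · rw [Set.indicator_of_notMem hx]
      obtain ⟨i, hi⟩ : ∃ i, x i ∉ s i := by simpa [Set.mem_pi] using hx
      exact (Finset.prod_eq_zero (Finset.mem_univ i) (Set.indicator_of_notMem hi _)).symm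
  rw [withDensity_apply _ (.univ_pi hs), ← lintegral_indicator (.univ_pi hs), hind]
  refine (lintegral_prod_eq_prod_lintegral_of_indepFun Finset.univ
    (fun i (x : ∀ i, X i) => (s i).indicator (f i) (x i))
    (iIndepFun_pi fun i => (hmeas i).aemeasurable)
    fun i => (hmeas i).comp (measurable_pi_apply i)).trans ?_
  refine Finset.prod_congr rfl fun i _ => ?_
  rw [withDensity_apply _ (hs i), ← lintegral_indicator (hs i),
    ← (measurePreserving_eval μ i).lintegral_comp (hmeas i)]

lemma Measure.map_withDensity_comp {X Y : Type*} {mX : MeasurableSpace X}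
    {mY : MeasurableSpace Y} (μ : Measure X) {T : X → Y} (hT : Measurable T)
    {f : Y → ENNReal} (hf : Measurable f) :
    (μ.withDensity (f ∘ T)).map T = (μ.map T).withDensity f := by
  ext s hs
  rw [Measure.map_apply hT hs, withDensity_apply _ (hT hs), withDensity_apply _ hs,
    setLIntegral_map hs hf hT]
  rfl

end MeasureTheory

namespace ProbabilityTheory

lemma gaussianReal_neg_mean_eq_withDensity (m : ℝ) :
    gaussianReal (-m) 1
      = (gaussianReal 0 1).withDensity
          (fun x => ENNReal.ofReal (Real.exp (-(m * x) - m ^ 2 / 2))) := by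
  rw [gaussianReal_of_var_ne_zero _ one_ne_zero, gaussianReal_of_var_ne_zero _ one_ne_zero,
    ← withDensity_mul _ (measurable_gaussianPDF 0 1) (by fun_prop)]
  congr 1
  ext x
  rw [Pi.mul_apply, gaussianPDF, gaussianPDF, ← ENNReal.ofReal_mul (gaussianPDFReal_nonneg _ _ _),
    gaussianPDFReal, gaussianPDFReal, mul_assoc (√_)⁻¹, ← Real.exp_add]
  congr 3
  push_cast
  ring

lemma pi_gaussianReal_map_sub {ι : Type*} [Fintype ι] (m : ι → ℝ) :
    (Measure.pi fun _ : ι => gaussianReal 0 1).map (fun ξ => ξ - m)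
      = (Measure.pi fun _ : ι => gaussianReal 0 1).withDensity
          (fun ξ => ENNReal.ofReal (Real.exp (∑ i, (-(m i * ξ i) - m i ^ 2 / 2)))) := by
  have hlaw (i : ι) : (gaussianReal 0 1).map (fun x => x - m i)
      = (gaussianReal 0 1).withDensity
          (fun x => ENNReal.ofReal (Real.exp (-(m i * x) - m i ^ 2 / 2))) := by
    rw [gaussianReal_map_sub_const, zero_sub, gaussianReal_neg_mean_eq_withDensity]
  have hσ (i : ι) : SigmaFinite ((gaussianReal 0 1).map (fun x => x - m i)) := by
    rw [gaussianReal_map_sub_const]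
    infer_instance
  have hσ' (i : ι) : SigmaFinite ((gaussianReal 0 1).withDensity
      (fun x => ENNReal.ofReal (Real.exp (-(m i * x) - m i ^ 2 / 2)))) := hlaw i ▸ hσ i
  have hmap := Measure.pi_map_pi (μ := fun _ : ι => gaussianReal 0 1)
    (f := fun i x => x - m i) (fun i => by fun_prop)
  refine hmap.trans ?_
  simp_rw [hlaw]
  rw [Measure.pi_withDensity _ (fun i => by fun_prop)]
  congr 1
  ext ξ
  rw [Real.exp_sum, ENNReal.ofReal_prod_of_nonneg fun i _ => (Real.exp_pos _).le]

/-- **Cameron–Martin formula** for a fibrewise shift of a standard Gaussian. -/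
lemma prod_pi_gaussianReal_map_sub {ι X : Type*} [Fintype ι] {mX : MeasurableSpace X}
    (μ : Measure X) [SFinite μ] {m : X → ι → ℝ} (hm : Measurable m) :
    (μ.prod (Measure.pi fun _ : ι => gaussianReal 0 1)).map (fun p => (p.1, p.2 - m p.1))
      = (μ.prod (Measure.pi fun _ : ι => gaussianReal 0 1)).withDensity
          (fun p => ENNReal.ofReal
            (Real.exp (∑ i, (-(m p.1 i * p.2 i) - m p.1 i ^ 2 / 2)))) := by
  refine Measure.ext_of_lintegral _ fun h hh => ?_
  have hS : Measurable fun p : X × (ι → ℝ) => (p.1, p.2 - m p.1) := by fun_prop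
  have hd : Measurable fun p : X × (ι → ℝ) => ENNReal.ofReal
      (Real.exp (∑ i, (-(m p.1 i * p.2 i) - m p.1 i ^ 2 / 2))) := by fun_prop
  rw [lintegral_map hh hS, lintegral_prod (fun p => h (p.1, p.2 - m p.1)) (hh.comp hS).aemeasurable,
    lintegral_withDensity_eq_lintegral_mul _ hd hh, lintegral_prod _ (hd.mul hh).aemeasurable]
  refine lintegral_congr fun u => ?_
  have hu : Measurable fun ξ : ι → ℝ => h (u, ξ) := hh.comp measurable_prodMk_left
  rw [← lintegral_map (f := fun ξ => h (u, ξ)) (g := fun ξ => ξ - m u) hu (by fun_prop),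
    pi_gaussianReal_map_sub, lintegral_withDensity_eq_lintegral_mul _ (by fun_prop) hu]
  rfl

end ProbabilityTheory

/-- The preconditioned Crank–Nicolson Langevin proposal density with respect to the pCN
reference measure: with target `μ1 = exp(−Φ) dμ0`, prior `μ0 = N(0, σ)`, step size
`δ ∈ (0,2)`, `β² = 8δ/(2+δ)²` and `c_β = 1 − √(1 − β²)`, the pCNL joint measure `ν_L` is
absolutely continuous with respect to the reference measure `ν⋆` and
`(dν_L/dν⋆)(u, v) = exp(−ρ(u, v))` with
`ρ(u,v) = Φ(u) + (δ/4)∑ σᵢ(∂ᵢΦ(u))² + (1/2)∑(vᵢ−uᵢ)∂ᵢΦ(u) + (δ/4)∑(vᵢ+uᵢ)∂ᵢΦ(u)`. -/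
theorem pCNL_density_wrt_reference
    (n : ℕ) (σ : Fin n → ℝ) (hσ : ∀ i, 0 < σ i)
    (Φ : (Fin n → ℝ) → ℝ) (hC1 : ContDiff ℝ 1 Φ)
    (hnorm : ∫ u, Real.exp (-Φ u)
      ∂(Measure.pi (fun i => gaussianReal 0 (σ i).toNNReal)) = 1)
    (μ1 : Measure (Fin n → ℝ))
    (hμ1 : μ1 = (Measure.pi (fun i => gaussianReal 0 (σ i).toNNReal)).withDensity
      (fun u => ENNReal.ofReal (Real.exp (-Φ u))))
    (δ : ℝ) (hδ : δ ∈ Set.Ioo (0 : ℝ) 2)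
    (β : ℝ) (hβ0 : 0 ≤ β) (hβ2 : β ^ 2 = 8 * δ / (2 + δ) ^ 2)
    (νL νstar : Measure ((Fin n → ℝ) × (Fin n → ℝ)))
    (hνL : νL = Measure.map
      (fun p : (Fin n → ℝ) × (Fin n → ℝ) =>
        (p.1, fun i => Real.sqrt (1 - β ^ 2) * p.1 i
          - (1 - Real.sqrt (1 - β ^ 2)) * σ i * fderiv ℝ Φ p.1 (Pi.single i 1)
          + β * Real.sqrt (σ i) * p.2 i))
      (μ1.prod (Measure.pi (fun _ : Fin n => gaussianReal 0 1))))
    (hνstar : νstar = Measure.map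
      (fun p : (Fin n → ℝ) × (Fin n → ℝ) =>
        (p.1, fun i => Real.sqrt (1 - β ^ 2) * p.1 i + β * Real.sqrt (σ i) * p.2 i))
      ((Measure.pi (fun i => gaussianReal 0 (σ i).toNNReal)).prod
        (Measure.pi (fun _ : Fin n => gaussianReal 0 1)))) :
    νL ≪ νstar ∧
      ∀ᵐ p ∂νstar, νL.rnDeriv νstar p
        = ENNReal.ofReal (Real.exp (-(Φ p.1
            + (δ / 4) * ∑ i, σ i * (fderiv ℝ Φ p.1 (Pi.single i 1)) ^ 2
            + (1 / 2) * ∑ i, (p.2 i - p.1 i) * fderiv ℝ Φ p.1 (Pi.single i 1)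
            + (δ / 4) * ∑ i, (p.2 i + p.1 i) * fderiv ℝ Φ p.1 (Pi.single i 1)))) := by
  obtain ⟨hδ0, hδ2⟩ := hδ
  have hδp : 0 < 2 + δ := by linarith
  have hβ : 0 < β := by
    have : 0 < β ^ 2 := by rw [hβ2]; positivity
    exact lt_of_le_of_ne hβ0 fun h => by simp [← h] at this
  have hsqrt : Real.sqrt (1 - β ^ 2) = (2 - δ) / (2 + δ) := by
    rw [Real.sqrt_eq_iff_mul_self_eq_of_pos (div_pos (by linarith) hδp), hβ2]
    field_simp
    ring
  set g : (Fin n → ℝ) → Fin n → ℝ := fun u i => fderiv ℝ Φ u (Pi.single i 1) with hg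
  have hgm : Measurable g := measurable_pi_lambda _ fun i =>
    ((hC1.continuous_fderiv one_ne_zero).clm_apply continuous_const).measurable
  have hΦm : Measurable Φ := hC1.continuous.measurable
  set c : ℝ := 1 - Real.sqrt (1 - β ^ 2) with hc
  set μ0 := Measure.pi (fun i => gaussianReal 0 (σ i).toNNReal) with hμ0
  set γ := Measure.pi (fun _ : Fin n => gaussianReal 0 1) with hγ
  set T : (Fin n → ℝ) × (Fin n → ℝ) → (Fin n → ℝ) × (Fin n → ℝ) := fun p =>
    (p.1, fun i => Real.sqrt (1 - β ^ 2) * p.1 i + β * Real.sqrt (σ i) * p.2 i) with hT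
  have hTm : Measurable T := by fun_prop
  set m : (Fin n → ℝ) → Fin n → ℝ := fun u i => c * σ i * g u i / (β * Real.sqrt (σ i)) with hmdef
  have hm : Measurable m := by fun_prop
  set f : (Fin n → ℝ) × (Fin n → ℝ) → ENNReal := fun p =>
    ENNReal.ofReal (Real.exp (-(Φ p.1
      + (δ / 4) * ∑ i, σ i * (g p.1 i) ^ 2
      + (1 / 2) * ∑ i, (p.2 i - p.1 i) * g p.1 i
      + (δ / 4) * ∑ i, (p.2 i + p.1 i) * g p.1 i))) with hf
  have hfm : Measurable f := by fun_prop
  have hwm : Measurable fun u => ENNReal.ofReal (Real.exp (-Φ u)) := by fun_prop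
  have hS : Measurable fun p : (Fin n → ℝ) × (Fin n → ℝ) => (p.1, p.2 - m p.1) := by fun_prop
  have hshift : νL = ((μ1.prod γ).map fun p => (p.1, p.2 - m p.1)).map T := by
    rw [hνL, Measure.map_map hTm hS]
    congr 1
    ext p i
    · rfl
    · have hs : Real.sqrt (σ i) ≠ 0 := (Real.sqrt_pos.2 (hσ i)).ne'
      simp only [hT, hmdef, Function.comp_apply, Pi.sub_apply, hg]
      field_simp
      ring
  have hdens (p : (Fin n → ℝ) × (Fin n → ℝ)) :
      ENNReal.ofReal (Real.exp (-Φ p.1)) * ENNReal.ofReal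
        (Real.exp (∑ i, (-(m p.1 i * p.2 i) - m p.1 i ^ 2 / 2))) = f (T p) := by
    rw [← ENNReal.ofReal_mul (Real.exp_pos _).le, ← Real.exp_add]
    simp only [hf, hT, neg_add, add_assoc]
    congr 3
    rw [Finset.mul_sum, Finset.mul_sum, Finset.mul_sum, ← Finset.sum_neg_distrib,
      ← Finset.sum_neg_distrib, ← Finset.sum_neg_distrib, ← Finset.sum_add_distrib,
      ← Finset.sum_add_distrib]
    refine Finset.sum_congr rfl fun i _ => ?_
    have hsq : σ i = Real.sqrt (σ i) ^ 2 := (Real.sq_sqrt (hσ i).le).symm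
    have hs : Real.sqrt (σ i) ≠ 0 := (Real.sqrt_pos.2 (hσ i)).ne'
    have hmi : m p.1 i = c * Real.sqrt (σ i) * g p.1 i / β := by
      simp only [hmdef]
      nth_rewrite 1 [hsq]
      field_simp
    have hcβ : c = (2 + δ) / 4 * β ^ 2 := by
      rw [hc, hsqrt, hβ2]
      field_simp
      ring
    have hβδ : β ^ 2 * (2 + δ) ^ 2 = 8 * δ := by
      rw [hβ2]
      field_simp
    have hmi' : m p.1 i = (2 + δ) / 4 * β * Real.sqrt (σ i) * g p.1 i := by
      rw [hmi, hcβ]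
      field_simp
    rw [hmi', hsqrt]
    nth_rewrite 3 [hsq]
    field_simp
    linear_combination (-(1 : ℝ)) * (Real.sqrt (σ i) ^ 2 * g p.1 i ^ 2 * (2 + δ)) * hβδ
  have hL : νL = νstar.withDensity f := by
    have hden : Measurable fun p : (Fin n → ℝ) × (Fin n → ℝ) => ENNReal.ofReal
        (Real.exp (∑ i, (-(m p.1 i * p.2 i) - m p.1 i ^ 2 / 2))) := by fun_prop
    have hfst : Measurable fun p : (Fin n → ℝ) × (Fin n → ℝ) =>
        ENNReal.ofReal (Real.exp (-Φ p.1)) := hwm.comp measurable_fst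
    have : SFinite μ1 := by rw [hμ1]; infer_instance
    rw [hshift, prod_pi_gaussianReal_map_sub μ1 hm, hμ1, prod_withDensity_left hwm,
      ← withDensity_mul _ hfst hden, hνstar,
      ← Measure.map_withDensity_comp _ hTm hfm]
    congr 2
    ext p
    exact hdens p
  have : IsProbabilityMeasure νstar := by
    rw [hνstar]
    exact Measure.isProbabilityMeasure_map hTm.aemeasurable
  rw [hL]
  exact ⟨withDensity_absolutelyContinuous _ _, Measure.rnDeriv_withDensity _ hfm⟩
end

section
/- Let d : Fin n → ℝ with d i > 0, m : Fin n → ℝ, β ∈ (0,1), c_β = 1 − Real.sqrt (1 − β²). Define the pCN_AM joint measure ν as the pushforward of μ1.prod η under (u, ξ) ↦ (u, fun i => (1 − c_β)·u i + c_β·m i + β·Real.sqrt (d i · σ i)·ξ i), and ν^⊥ = Measure.map Prod.swap ν. Then ν^⊥ and ν are equivalent, and for ν-almost every (u,v), (dν^⊥/dν)(u,v) = Real.exp (𝒥(u,v)) where 𝒥(u,v) = Φ(u) − Φ(v) + (1/2)·∑ᵢ (1/d i − 1)·((v i)² − (u i)²)/σ i − ∑ᵢ (v i − u i)·m i/(d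 i · σ i). (This is the Metropolis–Hastings ratio of the preconditioned Crank–Nicolson algorithm with adapted measure, pCN_AM.) -/
open MeasureTheory ProbabilityTheory
open scoped NNReal ENNReal

/-- A product of measures with real densities has the product of the densities as density. -/
theorem pi_withDensity_ofReal {ι : Type*} [Fintype ι] {α : ι → Type*}
    [∀ i, MeasurableSpace (α i)] (μ : ∀ i, Measure (α i)) [∀ i, SigmaFinite (μ i)]
    {f : ∀ i, α i → ℝ} (hf : ∀ i, Integrable (f i) (μ i)) (hf0 : ∀ i x, 0 ≤ f i x) :
    Measure.pi (fun i => (μ i).withDensity (fun x => ENNReal.ofReal (f i x)))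
      = (Measure.pi μ).withDensity (fun x => ENNReal.ofReal (∏ i, f i (x i))) := by
  refine Measure.pi_eq fun s hs => ?_
  have hfs : ∀ i, Integrable (f i) ((μ i).restrict (s i)) := fun i => (hf i).restrict
  rw [withDensity_apply _ (.univ_pi hs), Measure.restrict_pi_pi,
    ← ofReal_integral_eq_lintegral_ofReal (Integrable.fintype_prod_dep hfs)
      (ae_of_all _ fun x => Finset.prod_nonneg fun i _ => hf0 i _),
    integral_fintype_prod_eq_prod,
    ENNReal.ofReal_prod_of_nonneg fun i _ => integral_nonneg (hf0 i)]
  refine Finset.prod_congr rfl fun i _ => ?_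
  rw [withDensity_apply _ (hs i),
    ofReal_integral_eq_lintegral_ofReal (hfs i) (ae_of_all _ (hf0 i))]

/-- A product of nondegenerate real Gaussian measures has the product of the Gaussian densities
as density with respect to Lebesgue measure. -/
theorem pi_gaussianReal_eq_withDensity_s12 {ι : Type*} [Fintype ι] (a : ι → ℝ) {t : ι → ℝ≥0}
    (ht : ∀ i, t i ≠ 0) :
    Measure.pi (fun i => gaussianReal (a i) (t i))
      = volume.withDensity
          (fun x => ENNReal.ofReal (∏ i, gaussianPDFReal (a i) (t i) (x i))) := by
  simp_rw [gaussianReal_of_var_ne_zero _ (ht _)]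
  exact pi_withDensity_ofReal _ (fun i => integrable_gaussianPDFReal _ _)
    (fun i => gaussianPDFReal_nonneg _ _)

/-- An affine image of the standard Gaussian measure on `ι → ℝ`, coordinatewise. -/
theorem map_affine_pi_gaussianReal {ι : Type*} [Fintype ι] (a c : ι → ℝ) :
    Measure.map (fun (x : ι → ℝ) i => a i + c i * x i)
        (Measure.pi (fun _ : ι => gaussianReal 0 1))
      = Measure.pi (fun i => gaussianReal (a i) (c i ^ 2).toNNReal) := by
  have h (i : ι) : Measure.map (fun x => a i + c i * x) (gaussianReal 0 1)
      = gaussianReal (a i) (c i ^ 2).toNNReal := by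
    have hcomp : (fun x => a i + c i * x) = (a i + ·) ∘ (c i * ·) := rfl
    rw [hcomp, ← Measure.map_map (by fun_prop) (by fun_prop), gaussianReal_map_const_mul,
      gaussianReal_map_const_add]
    congr 1
    · simp
    · rw [mul_one]
      exact (Real.toNNReal_of_nonneg (sq_nonneg (c i))).symm
  have : ∀ i, SigmaFinite (Measure.map (fun x => a i + c i * x) (gaussianReal 0 1)) :=
    fun i => by rw [h]; infer_instance
  rw [Measure.pi_map_pi (f := fun i x => a i + c i * x) (fun i => by fun_prop)]
  simp_rw [h]

/-- The joint law of a random variable with density `f` and of one with conditional density `q`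
has density `f u * q u v`. -/
theorem map_prodMk_eq_withDensity {α β γ : Type*} [MeasurableSpace α] [MeasurableSpace β]
    [MeasurableSpace γ] {μ : Measure α} {η : Measure β} {κ : Measure γ} [SFinite μ] [SFinite η]
    [SFinite κ] {T : α × β → γ} (hT : Measurable T) {f : α → ℝ≥0∞} (hf : Measurable f)
    {q : α → γ → ℝ≥0∞} (hq : Measurable (Function.uncurry q))
    (h : ∀ u, η.map (fun x => T (u, x)) = κ.withDensity (q u)) :
    ((μ.withDensity f).prod η).map (fun p => (p.1, T p))
      = (μ.prod κ).withDensity (fun p => f p.1 * q p.1 p.2) := by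
  have hq' : Measurable fun p : α × γ => q p.1 p.2 := hq
  refine Measure.ext_of_lintegral _ fun φ hφ => ?_
  rw [lintegral_map hφ (by fun_prop), lintegral_prod _ (by fun_prop),
    lintegral_withDensity_eq_lintegral_mul _ hf (by fun_prop),
    lintegral_withDensity_eq_lintegral_mul _ (by fun_prop) hφ, lintegral_prod _ (by fun_prop)]
  refine lintegral_congr fun u => ?_
  have hqu : Measurable (q u) := hq.of_uncurry_left
  have hmap : ∫⁻ x, φ (u, T (u, x)) ∂η = ∫⁻ v, q u v * φ (u, v) ∂κ := by
    rw [← lintegral_map (f := fun v => φ (u, v)) (g := fun x => T (u, x)) (by fun_prop)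
      (by fun_prop), h, lintegral_withDensity_eq_lintegral_mul _ hqu (by fun_prop)]
    rfl
  simp only [Pi.mul_apply, mul_assoc]
  rw [hmap, lintegral_const_mul _ (by fun_prop)]

/-- If `ν` has density `ρ` with respect to a swap-invariant measure and `ρ (v, u)` equals
`ρ (u, v) * r (u, v)`, then the swap of `ν` has density `r` with respect to `ν`. -/
theorem map_swap_withDensity {α : Type*} [MeasurableSpace α] {κ : Measure (α × α)}
    (hκ : κ.map Prod.swap = κ) {ρ r : α × α → ℝ≥0∞} (hρ : Measurable ρ) (hr : Measurable r)
    (h : ∀ p, ρ p.swap = ρ p * r p) :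
    (κ.withDensity ρ).map Prod.swap = (κ.withDensity ρ).withDensity r := by
  refine Measure.ext_of_lintegral _ fun φ hφ => ?_
  rw [lintegral_map hφ measurable_swap,
    lintegral_withDensity_eq_lintegral_mul (g := fun p => φ p.swap) _ hρ
      (hφ.comp measurable_swap),
    ← withDensity_mul _ hρ hr, lintegral_withDensity_eq_lintegral_mul _ (hρ.mul hr) hφ]
  nth_rewrite 2 [← hκ]
  rw [lintegral_map ((hρ.mul hr).mul hφ) measurable_swap]
  refine lintegral_congr fun p => ?_
  simp [← h]

/-- The one-dimensional autoregressive proposal with stationary law `N(m, s)`, started from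
`N(0, t)`: exchanging the current and the proposed state multiplies the joint density by the
exponential of a quadratic form. -/
theorem gaussianPDFReal_mul_autoregressive_swap {t d β a : ℝ} (ht : 0 < t) (hd : 0 < d)
    (hβ : β ≠ 0) (ha : a ^ 2 = 1 - β ^ 2) (m u v : ℝ) :
    gaussianPDFReal 0 t.toNNReal v
        * gaussianPDFReal (a * v + (1 - a) * m) (β ^ 2 * (d * t)).toNNReal u
      = gaussianPDFReal 0 t.toNNReal u
        * gaussianPDFReal (a * u + (1 - a) * m) (β ^ 2 * (d * t)).toNNReal v
        * Real.exp ((1 / 2) * ((1 / d - 1) * (v ^ 2 - u ^ 2) / t) - (v - u) * m / (d * t)) := by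
  have hs : 0 < β ^ 2 * (d * t) := by positivity
  simp only [gaussianPDFReal, Real.coe_toNNReal _ ht.le, Real.coe_toNNReal _ hs.le]
  have key : -(v - 0) ^ 2 / (2 * t)
        + -(u - (a * v + (1 - a) * m)) ^ 2 / (2 * (β ^ 2 * (d * t)))
      = -(u - 0) ^ 2 / (2 * t) + -(v - (a * u + (1 - a) * m)) ^ 2 / (2 * (β ^ 2 * (d * t)))
        + ((1 / 2) * ((1 / d - 1) * (v ^ 2 - u ^ 2) / t) - (v - u) * m / (d * t)) := by
    field_simp
    linear_combination (-(v - u) * (v + u - 2 * m)) * ha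
  have hexp := congrArg Real.exp key
  rw [Real.exp_add, Real.exp_add, Real.exp_add] at hexp
  linear_combination (√(2 * Real.pi * t))⁻¹ * (√(2 * Real.pi * (β ^ 2 * (d * t))))⁻¹ * hexp


/-- Metropolis–Hastings ratio of the preconditioned Crank–Nicolson algorithm with
adapted measure (pCN_AM): with target `μ1 = exp(−Φ) dμ0`, prior `μ0 = N(0, σ)`,
adapted variances `d i · σ i`, adapted mean `m`, `β ∈ (0,1)` and
`c_β = 1 − √(1 − β²)`, letting `ν` denote the joint law of `(u, v)` with `u ∼ μ1` and
`v i = (1 − c_β) u i + c_β m i + β √(dᵢσᵢ) ξ i`, the swap `ν^⊥` is equivalent to `ν` and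
`(dν^⊥/dν)(u,v) = exp(𝒥(u,v))` with
`𝒥(u,v) = Φ(u) − Φ(v) + ½∑(1/dᵢ − 1)(vᵢ² − uᵢ²)/σᵢ − ∑(vᵢ − uᵢ)mᵢ/(dᵢσᵢ)`. -/
theorem pCN_AM_metropolis_hastings_ratio
    (n : ℕ) (σ : Fin n → ℝ) (hσ : ∀ i, 0 < σ i)
    (Φ : (Fin n → ℝ) → ℝ) (hΦ : Measurable Φ)
    (hnorm : ∫ u, Real.exp (-Φ u)
      ∂(Measure.pi (fun i => gaussianReal 0 (σ i).toNNReal)) = 1)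
    (μ1 : Measure (Fin n → ℝ))
    (hμ1 : μ1 = (Measure.pi (fun i => gaussianReal 0 (σ i).toNNReal)).withDensity
      (fun u => ENNReal.ofReal (Real.exp (-Φ u))))
    (d : Fin n → ℝ) (hd : ∀ i, 0 < d i) (m : Fin n → ℝ)
    (β : ℝ) (hβ : β ∈ Set.Ioo (0 : ℝ) 1)
    (ν : Measure ((Fin n → ℝ) × (Fin n → ℝ)))
    (hν : ν = Measure.map
      (fun p : (Fin n → ℝ) × (Fin n → ℝ) =>
        (p.1, fun i =>
          (1 - (1 - Real.sqrt (1 - β ^ 2))) * p.1 i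
            + (1 - Real.sqrt (1 - β ^ 2)) * m i
            + β * Real.sqrt (d i * σ i) * p.2 i))
      (μ1.prod (Measure.pi (fun _ : Fin n => gaussianReal 0 1)))) :
    (Measure.map Prod.swap ν ≪ ν ∧ ν ≪ Measure.map Prod.swap ν) ∧
      ∀ᵐ p ∂ν, (Measure.map Prod.swap ν).rnDeriv ν p
        = ENNReal.ofReal (Real.exp (Φ p.1 - Φ p.2
            + (1 / 2) * ∑ i, (1 / d i - 1) * ((p.2 i) ^ 2 - (p.1 i) ^ 2) / σ i
            - ∑ i, (p.2 i - p.1 i) * m i / (d i * σ i))) := by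
  obtain ⟨hβ0, hβ1⟩ := hβ
  set a : ℝ := √(1 - β ^ 2)
  have ha : a ^ 2 = 1 - β ^ 2 := Real.sq_sqrt (by nlinarith)
  have hs (i : Fin n) : 0 < β ^ 2 * (d i * σ i) :=
    mul_pos (pow_pos hβ0 2) (mul_pos (hd i) (hσ i))
  let f : (Fin n → ℝ) → ℝ := fun u => ∏ i, gaussianPDFReal 0 (σ i).toNNReal (u i)
  let q : (Fin n → ℝ) → (Fin n → ℝ) → ℝ := fun u v =>
    ∏ i, gaussianPDFReal (a * u i + (1 - a) * m i) (β ^ 2 * (d i * σ i)).toNNReal (v i)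
  let J : (Fin n → ℝ) × (Fin n → ℝ) → ℝ := fun p => Φ p.1 - Φ p.2
    + (1 / 2) * ∑ i, (1 / d i - 1) * ((p.2 i) ^ 2 - (p.1 i) ^ 2) / σ i
    - ∑ i, (p.2 i - p.1 i) * m i / (d i * σ i)
  have hf0 (u) : 0 ≤ f u := Finset.prod_nonneg fun i _ => gaussianPDFReal_nonneg _ _ _
  have hf : Measurable f := by
    simp only [f, gaussianPDFReal]
    fun_prop
  have hq : Measurable (Function.uncurry q) := by
    simp only [q, gaussianPDFReal, Function.uncurry_def]
    fun_prop
  have hJ : Measurable J := by fun_prop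
  let ρ : (Fin n → ℝ) × (Fin n → ℝ) → ℝ := fun p => f p.1 * Real.exp (-Φ p.1) * q p.1 p.2
  have hρ0 (p) : 0 ≤ ρ p := mul_nonneg (mul_nonneg (hf0 _) (Real.exp_nonneg _))
    (Finset.prod_nonneg fun i _ => gaussianPDFReal_nonneg _ _ _)
  have hρ : Measurable ρ := by
    have hq' : Measurable fun p : (Fin n → ℝ) × (Fin n → ℝ) => q p.1 p.2 := hq
    fun_prop
  have hν' : ν = (volume.prod volume).withDensity (fun p => ENNReal.ofReal (ρ p)) := by
    have hT (u : Fin n → ℝ) : Measure.map (fun x : Fin n → ℝ => fun i =>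
          (1 - (1 - a)) * u i + (1 - a) * m i + β * √(d i * σ i) * x i)
          (Measure.pi (fun _ : Fin n => gaussianReal 0 1))
        = volume.withDensity (fun v => ENNReal.ofReal (q u v)) := by
      rw [map_affine_pi_gaussianReal (fun i => (1 - (1 - a)) * u i + (1 - a) * m i)
        (fun i => β * √(d i * σ i))]
      simp only [mul_pow, Real.sq_sqrt (mul_pos (hd _) (hσ _)).le, sub_sub_cancel]
      exact pi_gaussianReal_eq_withDensity_s12 _ fun i => (Real.toNNReal_pos.2 (hs i)).ne'
    rw [hν, hμ1, pi_gaussianReal_eq_withDensity_s12 _ fun i => (Real.toNNReal_pos.2 (hσ i)).ne',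
      ← withDensity_mul _ (by fun_prop) (by fun_prop),
      map_prodMk_eq_withDensity (by fun_prop) (by fun_prop) (by fun_prop) hT]
    congr 1
    funext p
    rw [Pi.mul_apply, ← ENNReal.ofReal_mul (hf0 _),
      ← ENNReal.ofReal_mul (mul_nonneg (hf0 _) (Real.exp_nonneg _))]
  have hswap (p) : ρ p.swap = ρ p * Real.exp (J p) := by
    obtain ⟨u, v⟩ := p
    have hfq : f v * q v u = f u * q u v
        * Real.exp ((1 / 2) * ∑ i, (1 / d i - 1) * (v i ^ 2 - u i ^ 2) / σ i
          - ∑ i, (v i - u i) * m i / (d i * σ i)) := by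
      simp only [f, q]
      rw [Finset.mul_sum, ← Finset.sum_sub_distrib, Real.exp_sum, ← Finset.prod_mul_distrib,
        ← Finset.prod_mul_distrib, ← Finset.prod_mul_distrib]
      exact Finset.prod_congr rfl fun i _ =>
        gaussianPDFReal_mul_autoregressive_swap (hσ i) (hd i) hβ0.ne' ha _ _ _
    have hΦ' : Real.exp (-Φ v) = Real.exp (-Φ u) * Real.exp (Φ u - Φ v) := by
      rw [← Real.exp_add]
      ring_nf
    simp only [ρ, J, Prod.swap_prod_mk, add_sub_assoc, Real.exp_add (Φ u - Φ v)]
    linear_combination Real.exp (-Φ v) * hfq + f u * q u v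
      * Real.exp ((1 / 2) * ∑ i, (1 / d i - 1) * (v i ^ 2 - u i ^ 2) / σ i
          - ∑ i, (v i - u i) * m i / (d i * σ i)) * hΦ'
  have hr : Measurable fun p => ENNReal.ofReal (Real.exp (J p)) := by fun_prop
  have hrev : Measure.map Prod.swap ν
      = ν.withDensity (fun p => ENNReal.ofReal (Real.exp (J p))) := by
    rw [hν']
    refine map_swap_withDensity Measure.prod_swap hρ.ennreal_ofReal hr fun p => ?_
    rw [hswap, ENNReal.ofReal_mul (hρ0 p)]
  have : SigmaFinite ν := by
    rw [hν']
    infer_instance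
  rw [hrev]
  refine ⟨⟨withDensity_absolutelyContinuous _ _,
    withDensity_absolutelyContinuous' hr.aemeasurable ?_⟩, Measure.rnDeriv_withDensity ν hr⟩
  exact ae_of_all _ fun p => (ENNReal.ofReal_pos.2 (Real.exp_pos _)).ne'
end

section
/- Suppose Φ is continuously differentiable with partial derivatives ∂ᵢΦ. Let d : Fin n → ℝ with d i > 0, β ∈ (0,1), c_β = 1 − Real.sqrt (1 − β²), and for u ∈ E define m(u) : Fin n → ℝ by m(u) i = u i − d i · σ i · ∂ᵢΦ(u) − d i · u i. Define the pCNL_AM joint measure ν as the pushforward of μ1.prod η under (u, ξ) ↦ (u, fun i => (1 − c_β)·u i + c_β·m(u) i + β·Real.sqrt (d i · σ i)·ξ i), and ν^⊥ = Measure.map Prod.swap ν. Then ν^⊥ and ν are equivalent, and for ν-almost every (u,v), (dν^⊥/dν)(u,v) = Real.exp (𝒥(u,v)) where 𝒥(u,v) = Φ(u) − Φ(v) + (1/2)·∑ᵢ (1/d i − 1)·((v i)² − (u i)²)/σ i − (c_β/β²)·∑ᵢ m(u) i·(v i − (1 − c_β)·u i − (c_β/2)·m(u) i)/(d i · σ i)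 + (c_β/β²)·∑ᵢ m(v) i·(u i − (1 − c_β)·v i − (c_β/2)·m(v) i)/(d i · σ i). (This is the Metropolis–Hastings ratio of the preconditioned Crank–Nicolson Langevin algorithm with adapted measure, pCNL_AM.) -/
open MeasureTheory ProbabilityTheory

/-- Tonelli's theorem in `n` variables for products of functions of one variable each. -/
theorem lintegral_fin_prod_eq_prod {n : ℕ} {α : Type*} [MeasurableSpace α]
    {μ : Fin n → Measure α} [∀ i, SigmaFinite (μ i)]
    {f : Fin n → α → ENNReal} (hf : ∀ i, Measurable (f i)) :
    ∫⁻ x, ∏ i, f i (x i) ∂(Measure.pi μ) = ∏ i, ∫⁻ x, f i x ∂(μ i) := by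
  induction n with
  | zero => simp
  | succ n ih =>
    rw [← ((measurePreserving_piFinSuccAbove μ 0).symm).lintegral_comp_emb
      (MeasurableEquiv.measurableEmbedding _)]
    simp_rw [MeasurableEquiv.piFinSuccAbove_symm_apply, Fin.insertNthEquiv,
      Fin.prod_univ_succ, Fin.insertNth_zero, Equiv.coe_fn_mk, Fin.cons_succ,
      Fin.zero_succAbove, cast_eq, Fin.cons_zero]
    rw [← ih fun i => hf i.succ]
    have hg : Measurable fun y : Fin n → α => ∏ i : Fin n, f i.succ (y i) := by fun_prop
    exact lintegral_prod_mul (hf 0).aemeasurable hg.aemeasurable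

/-- A finite product of measures with densities has the product density. -/
theorem pi_withDensity_eq {n : ℕ} {α : Type*} [MeasurableSpace α]
    {μ : Fin n → Measure α} [∀ i, SigmaFinite (μ i)]
    {f : Fin n → α → ENNReal} (hf : ∀ i, Measurable (f i))
    [∀ i, SigmaFinite ((μ i).withDensity (f i))] :
    Measure.pi (fun i => (μ i).withDensity (f i))
      = (Measure.pi μ).withDensity (fun x => ∏ i, f i (x i)) := by
  refine Measure.pi_eq fun s hs => ?_
  rw [withDensity_apply _ (MeasurableSet.univ_pi hs), Measure.restrict_pi_pi,
    lintegral_fin_prod_eq_prod hf]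
  exact Finset.prod_congr rfl fun i _ => (withDensity_apply _ (hs i)).symm

theorem pi_gaussianReal_eq_withDensity_s13 {n : ℕ} (a : Fin n → ℝ) {v : Fin n → NNReal}
    (hv : ∀ i, v i ≠ 0) :
    Measure.pi (fun i => gaussianReal (a i) (v i))
      = volume.withDensity (fun x : Fin n → ℝ => ∏ i, gaussianPDF (a i) (v i) (x i)) := by
  have h i := gaussianReal_of_var_ne_zero (a i) (hv i)
  have (i : Fin n) : SigmaFinite (volume.withDensity (gaussianPDF (a i) (v i))) := by
    rw [← h]; infer_instance
  simp_rw [h]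
  exact pi_withDensity_eq fun i => measurable_gaussianPDF (a i) (v i)

theorem pi_gaussianReal_map_affine {n : ℕ} (a s : Fin n → ℝ) :
    (Measure.pi (fun _ : Fin n => gaussianReal 0 1)).map (fun ξ i => a i + s i * ξ i)
      = Measure.pi (fun i => gaussianReal (a i) (s i ^ 2).toNNReal) := by
  have h i : (gaussianReal 0 1).map (fun x => a i + s i * x)
      = gaussianReal (a i) (s i ^ 2).toNNReal := by
    rw [← Function.comp_def (fun x => a i + x) (fun x => s i * x),
      ← Measure.map_map (by fun_prop) (by fun_prop), gaussianReal_map_const_mul,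
      gaussianReal_map_const_add, Real.toNNReal_of_nonneg (sq_nonneg _)]
    simp
  have (i : Fin n) : SigmaFinite ((gaussianReal 0 1).map (fun x => a i + s i * x)) := by
    rw [h]; infer_instance
  simp_rw [← h]
  exact Measure.pi_map_pi (f := fun i x => a i + s i * x) fun i => by fun_prop

theorem prod_gaussianPDF_eq {n : ℕ} (a x : Fin n → ℝ) (v : Fin n → NNReal) :
    ∏ i, gaussianPDF (a i) (v i) (x i)
      = ENNReal.ofReal ((∏ i, (√(2 * Real.pi * v i))⁻¹)
          * Real.exp (∑ i, -(x i - a i) ^ 2 / (2 * v i))) := by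
  simp only [gaussianPDF]
  rw [← ENNReal.ofReal_prod_of_nonneg fun i _ => gaussianPDFReal_nonneg _ _ _]
  simp only [gaussianPDFReal, Finset.prod_mul_distrib, Real.exp_sum]

section Density

variable {α γ δ : Type*} [MeasurableSpace α] [MeasurableSpace γ] [MeasurableSpace δ]

/-- The joint law of `u ∼ w • μ` and `T u ξ`, where `T u ξ` has density `k u` with respect to
`ρ`, has density `w u * k u v` with respect to `μ.prod ρ`. -/
theorem map_prod_eq_withDensity {μ : Measure α} {η : Measure γ} {ρ : Measure δ}
    [SFinite μ] [SFinite η] [SFinite ρ] {w : α → ENNReal} (hw : Measurable w)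
    {T : α × γ → δ} (hT : Measurable T)
    {k : α × δ → ENNReal} (hk : Measurable k)
    (h : ∀ u, η.map (fun ξ => T (u, ξ)) = ρ.withDensity (fun v => k (u, v))) :
    ((μ.withDensity w).prod η).map (fun p => (p.1, T p))
      = (μ.prod ρ).withDensity (fun p => w p.1 * k p) := by
  have hm : Measurable fun p : α × γ => (p.1, T p) := by fun_prop
  ext s hs
  have hs' u : MeasurableSet (Prod.mk u ⁻¹' s) := measurable_prodMk_left hs
  have hwk : Measurable fun p : α × δ => w p.1 * k p := by fun_prop
  rw [Measure.map_apply hm hs, Measure.prod_apply (hm hs), withDensity_apply _ hs,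
    lintegral_withDensity_eq_lintegral_mul _ hw (measurable_measure_prodMk_left (hm hs)),
    ← lintegral_indicator hs, lintegral_prod _ (hwk.indicator hs).aemeasurable]
  refine lintegral_congr fun u => ?_
  have hku : Measurable fun v => k (u, v) := by fun_prop
  have hu : η (Prod.mk u ⁻¹' ((fun p : α × γ => (p.1, T p)) ⁻¹' s))
      = ρ.withDensity (fun v => k (u, v)) (Prod.mk u ⁻¹' s) := by
    rw [← h u, Measure.map_apply (by fun_prop) (hs' u)]
    rfl
  rw [Pi.mul_apply, hu, withDensity_apply _ (hs' u), ← lintegral_indicator (hs' u),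
    ← lintegral_const_mul _ (hku.indicator (hs' u))]
  refine lintegral_congr fun v => ?_
  by_cases hv : (u, v) ∈ s <;> simp [Set.indicator, hv]

theorem map_swap_withDensity_prod {μ : Measure α} {ρ : Measure γ} [SFinite μ] [SFinite ρ]
    {F : α × γ → ENNReal} (hF : Measurable F) :
    ((μ.prod ρ).withDensity F).map Prod.swap = (ρ.prod μ).withDensity (F ∘ Prod.swap) := by
  ext s hs
  rw [Measure.map_apply measurable_swap hs, withDensity_apply _ (measurable_swap hs),
    withDensity_apply _ hs, ← Measure.prod_swap,
    setLIntegral_map (measurable_swap hs) hF measurable_swap]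
  rfl

/-- If swapping the arguments of a joint density multiplies it by `exp ∘ J`, then the joint
law and its swap are equivalent, with Radon–Nikodym derivative `exp ∘ J`. -/
theorem swap_equiv_and_rnDeriv_eq_exp {μ : Measure α} [SFinite μ] {F : α × α → ENNReal}
    (hF : Measurable F) {ν : Measure (α × α)} [SigmaFinite ν]
    (hν : ν = (μ.prod μ).withDensity F) {J : α × α → ℝ} (hJ : Measurable J)
    (hFJ : ∀ p, F p.swap = F p * ENNReal.ofReal (Real.exp (J p))) :
    (ν.map Prod.swap ≪ ν ∧ ν ≪ ν.map Prod.swap) ∧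
      ∀ᵐ p ∂ν, (ν.map Prod.swap).rnDeriv ν p = ENNReal.ofReal (Real.exp (J p)) := by
  have hm : Measurable fun p => ENNReal.ofReal (Real.exp (J p)) := by fun_prop
  have hswap : ν.map Prod.swap = ν.withDensity fun p => ENNReal.ofReal (Real.exp (J p)) := by
    rw [hν, map_swap_withDensity_prod hF, ← withDensity_mul _ hF hm]
    exact congrArg _ (funext hFJ)
  rw [hswap]
  refine ⟨⟨withDensity_absolutelyContinuous _ _, withDensity_absolutelyContinuous'
    hm.aemeasurable (.of_forall fun p => ?_)⟩, Measure.rnDeriv_withDensity _ hm⟩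
  simpa using Real.exp_pos _

end Density

/-- Metropolis–Hastings ratio of the preconditioned Crank–Nicolson Langevin algorithm
with adapted measure (pCNL_AM): with target `μ1 = exp(−Φ) dμ0`, prior `μ0 = N(0, σ)`,
adapted variances `d i · σ i`, drift `m(u) i = u i − dᵢσᵢ∂ᵢΦ(u) − dᵢuᵢ`, `β ∈ (0,1)` and
`c_β = 1 − √(1 − β²)`, letting `ν` denote the joint law of `(u, v)` with `u ∼ μ1` and
`v i = (1 − c_β) u i + c_β m(u) i + β √(dᵢσᵢ) ξ i`, the swap `ν^⊥` is equivalent to `ν`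
and `(dν^⊥/dν)(u,v) = exp(𝒥(u,v))` with
`𝒥(u,v) = Φ(u) − Φ(v) + ½∑(1/dᵢ − 1)(vᵢ² − uᵢ²)/σᵢ
  − (c_β/β²)∑ m(u)ᵢ(vᵢ − (1 − c_β)uᵢ − (c_β/2)m(u)ᵢ)/(dᵢσᵢ)
  + (c_β/β²)∑ m(v)ᵢ(uᵢ − (1 − c_β)vᵢ − (c_β/2)m(v)ᵢ)/(dᵢσᵢ)`. -/
theorem pCNL_AM_metropolis_hastings_ratio
    (n : ℕ) (σ : Fin n → ℝ) (hσ : ∀ i, 0 < σ i)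
    (Φ : (Fin n → ℝ) → ℝ) (hC1 : ContDiff ℝ 1 Φ)
    (hnorm : ∫ u, Real.exp (-Φ u)
      ∂(Measure.pi (fun i => gaussianReal 0 (σ i).toNNReal)) = 1)
    (μ1 : Measure (Fin n → ℝ))
    (hμ1 : μ1 = (Measure.pi (fun i => gaussianReal 0 (σ i).toNNReal)).withDensity
      (fun u => ENNReal.ofReal (Real.exp (-Φ u))))
    (d : Fin n → ℝ) (hd : ∀ i, 0 < d i)
    (β : ℝ) (hβ : β ∈ Set.Ioo (0 : ℝ) 1)
    (cβ : ℝ) (hcβ : cβ = 1 - Real.sqrt (1 - β ^ 2))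
    (mfun : (Fin n → ℝ) → Fin n → ℝ)
    (hmfun : ∀ u i, mfun u i
      = u i - d i * σ i * fderiv ℝ Φ u (Pi.single i 1) - d i * u i)
    (ν : Measure ((Fin n → ℝ) × (Fin n → ℝ)))
    (hν : ν = Measure.map
      (fun p : (Fin n → ℝ) × (Fin n → ℝ) =>
        (p.1, fun i =>
          (1 - cβ) * p.1 i + cβ * mfun p.1 i + β * Real.sqrt (d i * σ i) * p.2 i))
      (μ1.prod (Measure.pi (fun _ : Fin n => gaussianReal 0 1)))) :
    (Measure.map Prod.swap ν ≪ ν ∧ ν ≪ Measure.map Prod.swap ν) ∧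
      ∀ᵐ p ∂ν, (Measure.map Prod.swap ν).rnDeriv ν p
        = ENNReal.ofReal (Real.exp (Φ p.1 - Φ p.2
            + (1 / 2) * ∑ i, (1 / d i - 1) * ((p.2 i) ^ 2 - (p.1 i) ^ 2) / σ i
            - (cβ / β ^ 2) * ∑ i, mfun p.1 i
                * (p.2 i - (1 - cβ) * p.1 i - (cβ / 2) * mfun p.1 i) / (d i * σ i)
            + (cβ / β ^ 2) * ∑ i, mfun p.2 i
                * (p.1 i - (1 - cβ) * p.2 i - (cβ / 2) * mfun p.2 i) / (d i * σ i))) := by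
  obtain ⟨hβ0, hβ1⟩ := hβ
  have hc : (1 - cβ) ^ 2 = 1 - β ^ 2 := by
    rw [hcβ, sub_sub_cancel, Real.sq_sqrt (by nlinarith)]
  have hm i : Measurable fun u => mfun u i := by
    simp only [hmfun]
    have := (hC1.continuous_fderiv one_ne_zero).measurable
    fun_prop
  have hΦ : Measurable Φ := hC1.continuous.measurable
  have hvar i : 0 < d i * σ i := mul_pos (hd i) (hσ i)
  have hτ i : (β * √(d i * σ i)) ^ 2 = β ^ 2 * (d i * σ i) := by
    rw [mul_pow, Real.sq_sqrt (hvar i).le]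
  have hτ0 i : 0 < β ^ 2 * (d i * σ i) := mul_pos (pow_pos hβ0 2) (hvar i)
  have hσ' i : (σ i).toNNReal ≠ 0 := by simpa using hσ i
  set w : (Fin n → ℝ) → ENNReal := fun u =>
    (∏ i, gaussianPDF 0 (σ i).toNNReal (u i)) * ENNReal.ofReal (Real.exp (-Φ u)) with hw
  set k : (Fin n → ℝ) × (Fin n → ℝ) → ENNReal := fun p =>
    ∏ i, gaussianPDF ((1 - cβ) * p.1 i + cβ * mfun p.1 i)
      (β ^ 2 * (d i * σ i)).toNNReal (p.2 i) with hk
  have hpdf (i : Fin n) : Measurable fun p : (Fin n → ℝ) × (Fin n → ℝ) =>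
      gaussianPDF ((1 - cβ) * p.1 i + cβ * mfun p.1 i)
        (β ^ 2 * (d i * σ i)).toNNReal (p.2 i) := by
    have : Measurable fun p : (Fin n → ℝ) × (Fin n → ℝ) =>
        ((1 - cβ) * p.1 i + cβ * mfun p.1 i, (β ^ 2 * (d i * σ i)).toNNReal, p.2 i) := by
      fun_prop
    exact measurable_uncurry_gaussianPDF.comp this
  have hwm : Measurable w := by fun_prop
  have hkm : Measurable k := by fun_prop
  have hμ1w : μ1 = volume.withDensity w := by
    rw [hμ1, pi_gaussianReal_eq_withDensity_s13 _ hσ', ← withDensity_mul _ (by fun_prop) (by fun_prop)]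
    rfl
  have hνk : ν = (volume.prod volume).withDensity (fun p => w p.1 * k p) := by
    rw [hν, hμ1w]
    refine map_prod_eq_withDensity hwm (by fun_prop) hkm fun u => ?_
    rw [pi_gaussianReal_map_affine (fun i => (1 - cβ) * u i + cβ * mfun u i)]
    simp_rw [hτ]
    exact pi_gaussianReal_eq_withDensity_s13 _ fun i => by simpa using hτ0 i
  have hF p : w p.1 * k p = ENNReal.ofReal
      ((∏ i, (√(2 * Real.pi * (σ i).toNNReal))⁻¹)
        * (∏ i, (√(2 * Real.pi * (β ^ 2 * (d i * σ i)).toNNReal))⁻¹)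
        * Real.exp (-Φ p.1 + ∑ i, -(p.1 i) ^ 2 / (2 * σ i)
          + ∑ i, -(p.2 i - ((1 - cβ) * p.1 i + cβ * mfun p.1 i)) ^ 2
            / (2 * (β ^ 2 * (d i * σ i))))) := by
    simp only [hw, hk]
    rw [prod_gaussianPDF_eq, prod_gaussianPDF_eq, ← ENNReal.ofReal_mul (by positivity),
      ← ENNReal.ofReal_mul (by positivity)]
    simp only [Real.coe_toNNReal _ (hσ _).le, Real.coe_toNNReal _ (hτ0 _).le, sub_zero,
      Real.exp_add]
    congr 1
    ring
  have : SigmaFinite ν := by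
    simp only [hνk, hF]
    infer_instance
  refine swap_equiv_and_rnDeriv_eq_exp (hwm.comp measurable_fst |>.mul hkm) hνk
    (by fun_prop) fun p => ?_
  simp only [Pi.mul_apply, Function.comp_apply]
  rw [hF p, hF p.swap, ← ENNReal.ofReal_mul (by positivity), mul_assoc _ (Real.exp _),
    ← Real.exp_add]
  congr 3
  simp only [Prod.fst_swap, Prod.snd_swap, Finset.mul_sum]
  have hsum : ∑ i, -(p.2 i) ^ 2 / (2 * σ i)
      + ∑ i, -(p.1 i - ((1 - cβ) * p.2 i + cβ * mfun p.2 i)) ^ 2 / (2 * (β ^ 2 * (d i * σ i)))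
    = ∑ i, -(p.1 i) ^ 2 / (2 * σ i)
      + ∑ i, -(p.2 i - ((1 - cβ) * p.1 i + cβ * mfun p.1 i)) ^ 2 / (2 * (β ^ 2 * (d i * σ i)))
      + ∑ i, 1 / 2 * ((1 / d i - 1) * ((p.2 i) ^ 2 - (p.1 i) ^ 2) / σ i)
      - ∑ i, cβ / β ^ 2 * (mfun p.1 i
          * (p.2 i - (1 - cβ) * p.1 i - cβ / 2 * mfun p.1 i) / (d i * σ i))
      + ∑ i, cβ / β ^ 2 * (mfun p.2 i
          * (p.1 i - (1 - cβ) * p.2 i - cβ / 2 * mfun p.2 i) / (d i * σ i)) := by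
    simp only [← Finset.sum_add_distrib, ← Finset.sum_sub_distrib]
    refine Finset.sum_congr rfl fun i _ => ?_
    have h1 := (hσ i).ne'
    have h2 := (hd i).ne'
    field_simp
    linear_combination ((p.1 i) ^ 2 - (p.2 i) ^ 2) * hc
  linear_combination hsum
end

section
/- Let d : Fin n → ℝ with d i > 0 for all i and let Ψ = N(0, fun i => d i · σ i). Then μ1 ≪ Ψ and, for Ψ-almost every u, the Radon–Nikodym derivative satisfies (dμ1/dΨ)(u) = (∏ᵢ Real.sqrt (d i)) · Real.exp (−Φ̃(u)), where Φ̃(u) = Φ(u) + (1/2)·∑ᵢ (1 − 1/d i)·(u i)²/σ i is the modified potential. That is, the target measure may be represented with respect to the changed Gaussian base measure Ψ by adding the quadratic correction term to the potential. -/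
open MeasureTheory ProbabilityTheory

/-- A product of measures with densities has the product of the densities as its density. -/
theorem pi_withDensity_eq_withDensity_prod {ι : Type*} [Fintype ι] {α : ι → Type*}
    [∀ i, MeasurableSpace (α i)] (μ : ∀ i, Measure (α i)) [∀ i, IsProbabilityMeasure (μ i)]
    (f : ∀ i, α i → ENNReal) (hf : ∀ i, Measurable (f i))
    [∀ i, SigmaFinite ((μ i).withDensity (f i))] :
    Measure.pi (fun i => (μ i).withDensity (f i)) =
      (Measure.pi μ).withDensity (fun x => ∏ i, f i (x i)) := by
  classical
  refine Measure.pi_eq fun s hs => ?_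
  have hind : ∀ i, Measurable ((s i).indicator (f i)) := fun i => (hf i).indicator (hs i)
  rw [withDensity_apply _ (MeasurableSet.univ_pi hs),
    ← lintegral_indicator (MeasurableSet.univ_pi hs)]
  have hprod : ∀ x : ∀ i, α i, (Set.univ.pi s).indicator (fun x => ∏ i, f i (x i)) x =
      ∏ i, (s i).indicator (f i) (x i) := by
    intro x
    by_cases hx : x ∈ Set.univ.pi s
    · rw [Set.indicator_of_mem hx]
      exact Finset.prod_congr rfl fun i _ =>
        (Set.indicator_of_mem (hx i (Set.mem_univ i)) (f i)).symm
    · rw [Set.indicator_of_notMem hx]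
      obtain ⟨i, hi⟩ : ∃ i, x i ∉ s i := by simpa [Set.mem_pi] using hx
      exact (Finset.prod_eq_zero (Finset.mem_univ i) (Set.indicator_of_notMem hi (f i))).symm
  simp_rw [hprod]
  rw [lintegral_prod_eq_prod_lintegral_of_indepFun Finset.univ
    (fun i (x : ∀ i, α i) => (s i).indicator (f i) (x i))
    (iIndepFun_pi fun i => (hind i).aemeasurable)
    (fun i => (hind i).comp (measurable_pi_apply i))]
  refine Finset.prod_congr rfl fun i _ => ?_
  rw [withDensity_apply _ (hs i), ← lintegral_indicator (hs i)]
  exact (measurePreserving_eval μ i).lintegral_comp (hind i)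

/-- The density of a centered real Gaussian measure with respect to the centered Gaussian measure
whose variance is `d` times as large. -/
theorem gaussianReal_eq_withDensity_gaussianReal_mul_var {v d : ℝ} (hv : 0 < v) (hd : 0 < d) :
    gaussianReal 0 v.toNNReal = (gaussianReal 0 (d * v).toNNReal).withDensity
      (fun x => ENNReal.ofReal (√d * Real.exp (-((1 / 2) * ((1 - 1 / d) * x ^ 2 / v))))) := by
  have hdv : 0 < d * v := mul_pos hd hv
  rw [gaussianReal_of_var_ne_zero 0 (Real.toNNReal_pos.2 hv).ne',
    gaussianReal_of_var_ne_zero 0 (Real.toNNReal_pos.2 hdv).ne',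
    ← withDensity_mul _ (measurable_gaussianPDF _ _) (by fun_prop)]
  congr 1
  ext x
  rw [Pi.mul_apply, gaussianPDF, gaussianPDF, ← ENNReal.ofReal_mul (gaussianPDFReal_nonneg _ _ _)]
  congr 1
  rw [gaussianPDFReal, gaussianPDFReal, Real.coe_toNNReal _ hv.le, Real.coe_toNNReal _ hdv.le,
    mul_mul_mul_comm, ← Real.exp_add]
  congr 1
  · rw [show 2 * Real.pi * (d * v) = d * (2 * Real.pi * v) by ring, Real.sqrt_mul hd.le]
    have := (Real.sqrt_pos.2 hd).ne'
    field_simp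
  · congr 1
    field_simp
    ring

/-- Change of base measure: the target `μ1 = exp(−Φ) dμ0` with prior `μ0 = N(0, σ)` is
absolutely continuous with respect to the changed Gaussian base measure
`Ψ = N(0, d·σ)`, with density
`(dμ1/dΨ)(u) = (∏ᵢ √(dᵢ)) · exp(−Φ̃(u))` where the modified potential is
`Φ̃(u) = Φ(u) + ½∑ᵢ(1 − 1/dᵢ)uᵢ²/σᵢ`. -/
theorem target_density_wrt_changed_base_measure
    (n : ℕ) (σ : Fin n → ℝ) (hσ : ∀ i, 0 < σ i)
    (Φ : (Fin n → ℝ) → ℝ) (hΦ : Measurable Φ)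
    (hnorm : ∫ u, Real.exp (-Φ u)
      ∂(Measure.pi (fun i => gaussianReal 0 (σ i).toNNReal)) = 1)
    (μ1 : Measure (Fin n → ℝ))
    (hμ1 : μ1 = (Measure.pi (fun i => gaussianReal 0 (σ i).toNNReal)).withDensity
      (fun u => ENNReal.ofReal (Real.exp (-Φ u))))
    (d : Fin n → ℝ) (hd : ∀ i, 0 < d i)
    (Ψ : Measure (Fin n → ℝ))
    (hΨ : Ψ = Measure.pi (fun i => gaussianReal 0 (d i * σ i).toNNReal)) :
    μ1 ≪ Ψ ∧
      ∀ᵐ u ∂Ψ, μ1.rnDeriv Ψ u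
        = ENNReal.ofReal ((∏ i, Real.sqrt (d i))
            * Real.exp (-(Φ u + (1 / 2) * ∑ i, (1 - 1 / d i) * (u i) ^ 2 / σ i))) := by
  have hcoord : ∀ i, Measurable fun x : ℝ => ENNReal.ofReal
      (√(d i) * Real.exp (-((1 / 2) * ((1 - 1 / d i) * x ^ 2 / σ i)))) := fun i => by fun_prop
  have hgauss := fun i => gaussianReal_eq_withDensity_gaussianReal_mul_var (hσ i) (hd i)
  have : ∀ i, SigmaFinite ((gaussianReal 0 (d i * σ i).toNNReal).withDensity fun x : ℝ =>
      ENNReal.ofReal (√(d i) * Real.exp (-((1 / 2) * ((1 - 1 / d i) * x ^ 2 / σ i))))) :=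
    fun i => by rw [← hgauss i]; infer_instance
  have hdens : μ1 = Ψ.withDensity (fun u => ENNReal.ofReal ((∏ i, √(d i))
      * Real.exp (-(Φ u + (1 / 2) * ∑ i, (1 - 1 / d i) * (u i) ^ 2 / σ i)))) := by
    rw [hμ1, hΨ, funext hgauss, pi_withDensity_eq_withDensity_prod _ _ hcoord,
      ← withDensity_mul _ (by fun_prop) (by fun_prop)]
    congr 1
    ext u
    rw [Pi.mul_apply, ← ENNReal.ofReal_prod_of_nonneg fun i _ => by positivity,
      ← ENNReal.ofReal_mul (Finset.prod_nonneg fun i _ => by positivity),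
      Finset.prod_mul_distrib, ← Real.exp_sum, mul_assoc, ← Real.exp_add,
      Finset.sum_neg_distrib, ← Finset.mul_sum, neg_add_rev]
  have : SigmaFinite Ψ := by rw [hΨ]; infer_instance
  rw [hdens]
  exact ⟨withDensity_absolutelyContinuous _ _, Ψ.rnDeriv_withDensity (by fun_prop)⟩
end
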